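/- Let G be a 2-connected graph. If G is both K_{1,3}-f-heavy and W-f-heavy, where W (the wounded) is the triangle with a pendant edge attached at one vertex and a pendant path of two edges attached at another vertex, then G is Hamiltonian. -/

import Mathlib

open SimpleGraph

/-- `G` contains a cycle of length `k`. -/
def HasCycleLength {V : Type} (G : SimpleGraph V) (k : ℕ) : Prop :=
  ∃ (v : V) (c : G.Walk v v), c.IsCycle ∧ c.length = k

/-- A graph on `n` vertices is pancyclic if it contains cycles of every length from 3 to `n`. -/
def IsPancyclic {V : Type} [Fintype V] (G : SimpleGraph V) : Prop :=
  ∀ k : ℕ, 3 ≤ k → k ≤ Fintype.card V → HasCycleLength G k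

/-- A graph is Hamiltonian if it contains a spanning cycle. -/
def IsHamiltonianGraph {V : Type} (G : SimpleGraph V) : Prop :=
  ∃ (v : V) (c : G.Walk v v), c.IsCycle ∧ ∀ u : V, u ∈ c.support

/-- A graph is 2-connected if it has at least 3 vertices and deleting any single
vertex leaves a connected graph. -/
def TwoConnected {V : Type} [Fintype V] (G : SimpleGraph V) : Prop :=
  3 ≤ Fintype.card V ∧ ∀ v : V, (G.induce {u : V | u ≠ v}).Connected

/-- A (finite) graph is a cycle iff it is connected and 2-regular. -/
def IsCycleGraph {V : Type} [Fintype V] (G : SimpleGraph V) [DecidableRel G.Adj] : Prop :=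
  G.Connected ∧ ∀ v : V, G.degree v = 2

/-- `G` is `R`-f₁-heavy: for every induced copy of `R` in `G` (given by a graph
embedding `f : R ↪g G`) and every pair of vertices at distance 2 in that copy,
one of them has degree at least `(n+1)/2` in `G`. -/
def F1Heavy {V W : Type} [Fintype V] (G : SimpleGraph V) [DecidableRel G.Adj]
    (R : SimpleGraph W) : Prop :=
  ∀ (f : R ↪g G) (a b : W), R.dist a b = 2 →
    Fintype.card V + 1 ≤ 2 * max (G.degree (f a)) (G.degree (f b))

/-- `G` is `R`-f-heavy: as above but with degree at least `n/2`. -/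
def FHeavy {V W : Type} [Fintype V] (G : SimpleGraph V) [DecidableRel G.Adj]
    (R : SimpleGraph W) : Prop :=
  ∀ (f : R ↪g G) (a b : W), R.dist a b = 2 →
    Fintype.card V ≤ 2 * max (G.degree (f a)) (G.degree (f b))

/-- `G` is `R`-free: no induced subgraph of `G` is isomorphic to `R`. -/
def RFree {V W : Type} (G : SimpleGraph V) (R : SimpleGraph W) : Prop :=
  IsEmpty (R ↪g G)

/-- The claw `K_{1,3}`: vertex `0` is the center, adjacent to `1`, `2`, `3`. -/
def claw : SimpleGraph (Fin 4) := SimpleGraph.fromRel (fun a _ => a = 0)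

/-- `Z_i`: the path `0 1 2 ... (i+2)` together with the chord `{0,2}`,
i.e. a triangle `0 1 2` with a path of `i` edges attached at vertex `2`. -/
def Zgraph (i : ℕ) : SimpleGraph (Fin (i + 3)) :=
  SimpleGraph.fromRel (fun a b => b.val = a.val + 1 ∨ (a.val = 0 ∧ b.val = 2))

/-- The net `N`: triangle `0 1 2` with pendant edges `0-3`, `1-4`, `2-5`. -/
def netGraph : SimpleGraph (Fin 6) :=
  SimpleGraph.fromRel (fun a b =>
    (a.val = 0 ∧ b.val = 1) ∨ (a.val = 1 ∧ b.val = 2) ∨ (a.val = 0 ∧ b.val = 2) ∨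
    (a.val = 0 ∧ b.val = 3) ∨ (a.val = 1 ∧ b.val = 4) ∨ (a.val = 2 ∧ b.val = 5))

/-- The wounded `W`: triangle `0 1 2` with a pendant edge `0-3` and a pendant
path `1-4-5` of two edges. -/
def woundedGraph : SimpleGraph (Fin 6) :=
  SimpleGraph.fromRel (fun a b =>
    (a.val = 0 ∧ b.val = 1) ∨ (a.val = 1 ∧ b.val = 2) ∨ (a.val = 0 ∧ b.val = 2) ∨
    (a.val = 0 ∧ b.val = 3) ∨ (a.val = 1 ∧ b.val = 4) ∨ (a.val = 4 ∧ b.val = 5))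



/-- `HP F X x y`: `X` is the vertex set of a path of `F` from `x` to `y`. -/
inductive HP {V : Type} [DecidableEq V] (F : SimpleGraph V) : Finset V → V → V → Prop
  | single (x : V) : HP F {x} x x
  | cons {X : Finset V} {x y z : V} : F.Adj x y → x ∉ X → HP F X y z → HP F (insert x X) x z

namespace HP

variable {V : Type} [DecidableEq V] {F : SimpleGraph V}

theorem left_mem {X : Finset V} {x y : V} (h : HP F X x y) : x ∈ X := by
  cases h <;> simp

theorem right_mem {X : Finset V} {x y : V} (h : HP F X x y) : y ∈ X := by
  induction h <;> simp_all

theorem congr_set {X Y : Finset V} {x y : V} (h : HP F X x y) (e : X = Y) : HP F Y x y := e ▸ h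

theorem join {X Y : Finset V} {x y y' z : V} (h : HP F X x y) (h' : HP F Y y' z)
    (ha : F.Adj y y') (hd : Disjoint X Y) : HP F (X ∪ Y) x z := by
  induction h with
  | single x => 
    refine congr_set (HP.cons ha ?_ h') ?_
    · simpa using hd
    · rfl
  | @cons X x w z h1 h2 h3 ih =>
    rw [Finset.disjoint_insert_left] at hd
    refine congr_set (HP.cons h1 ?_ (ih ha hd.2)) ?_
    · simp [h2, hd.1]
    · ext; simp

theorem rev {X : Finset V} {x y : V} (h : HP F X x y) : HP F X y x := by
  induction h with
  | single x => exact HP.single x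
  | @cons X x w z h1 h2 h3 ih =>
    refine congr_set (join ih (HP.single x) h1.symm ?_) ?_
    · simpa using h2
    · ext; simp

theorem mono {F' : SimpleGraph V} (hF : F ≤ F') {X : Finset V} {x y : V} (h : HP F X x y) :
    HP F' X x y := by
  induction h with
  | single x => exact HP.single x
  | cons h1 h2 h3 ih => exact HP.cons (hF h1) h2 ih

theorem initial_mem {X : Finset V} {x y w : V} (h : HP F X x y) (hw : w ∈ X) :
    ∃ A, A ⊆ X ∧ HP F A x w := by
  induction h with
  | single x => 
    simp at hw; subst hw; exact ⟨_, subset_rfl, HP.single _⟩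
  | @cons X x y z h1 h2 h3 ih =>
    by_cases hx : w = x
    · subst hx; exact ⟨{w}, by simp, HP.single _⟩
    · obtain ⟨A, hA, hA'⟩ := ih (by simpa [hx] using hw)
      exact ⟨insert x A, Finset.insert_subset_insert _ hA, HP.cons h1 (fun h => h2 (hA h)) hA'⟩

theorem pair {x y : V} (h : F.Adj x y) : HP F {x, y} x y :=
  HP.cons h (by simpa using h.ne) (HP.single y)

theorem card_two {X : Finset V} {x y : V} (h : HP F X x y) (hxy : x ≠ y) : 2 ≤ X.card := by
  have : ({x, y} : Finset V) ⊆ X := by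
    intro a ha
    simp at ha
    rcases ha with rfl | rfl
    · exact h.left_mem
    · exact h.right_mem
  have h2 := Finset.card_le_card this
  rw [Finset.card_pair hxy] at h2
  exact h2

theorem exists_walk {X : Finset V} {x y : V} (h : HP F X x y) :
    ∃ p : F.Walk x y, p.IsPath ∧ ∀ v, v ∈ p.support ↔ v ∈ X := by
  induction h with
  | single x => exact ⟨SimpleGraph.Walk.nil, by simp, by simp⟩
  | @cons X x y z h1 h2 h3 ih =>
    obtain ⟨p, hp, hs⟩ := ih
    refine ⟨SimpleGraph.Walk.cons h1 p, ?_, ?_⟩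
    · rw [SimpleGraph.Walk.cons_isPath_iff]
      exact ⟨hp, by rw [hs]; exact h2⟩
    · intro v; simp [hs]

theorem exists_fun {X : Finset V} {x y : V} (h : HP F X x y) :
    ∃ f : ℕ → V, f 0 = x ∧ f (X.card - 1) = y ∧ (∀ k, k + 1 < X.card → F.Adj (f k) (f (k+1))) ∧
      (∀ k, k < X.card → f k ∈ X) ∧
      (∀ k l, k < X.card → l < X.card → f k = f l → k = l) := by
  induction h with
  | single x => 
    refine ⟨fun _ => x, rfl, rfl, ?_, ?_, ?_⟩
    · simp
    · simp
    · intro k l; simp; omega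
  | @cons X x y z h1 h2 h3 ih =>
    obtain ⟨f, f0, fl, fa, fm, fi⟩ := ih
    have hpos : 0 < X.card := Finset.card_pos.2 ⟨_, h3.left_mem⟩
    refine ⟨fun k => if k = 0 then x else f (k - 1), by simp, ?_, ?_, ?_, ?_⟩
    · rw [Finset.card_insert_of_notMem h2]
      have h0 : X.card + 1 - 1 ≠ 0 := by omega
      simp only [if_neg h0]
      simpa using fl
    · intro k hk
      rw [Finset.card_insert_of_notMem h2] at hk
      rcases k with _ | k
      · simpa [f0] using h1
      · simpa using fa k (by omega)
    · intro k hk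
      rw [Finset.card_insert_of_notMem h2] at hk
      rcases k with _ | k
      · simp
      · simpa using Or.inr (fm k (by omega))
    · intro k l hk hl
      rw [Finset.card_insert_of_notMem h2] at hk hl
      rcases k with _ | k <;> rcases l with _ | l
      · simp
      · simp; intro e; exact h2 (e ▸ fm l (by omega))
      · simp; intro e; exact h2 (e ▸ fm k (by omega))
      · simp; intro e; exact fi k l (by omega) (by omega) e

/-- A path on a clique containing `z`, ending at `z`. -/
theorem of_clique (Y : Finset V) (z : V) (hz : z ∉ Y)
    (h : ∀ a ∈ insert z Y, ∀ b ∈ insert z Y, a ≠ b → F.Adj a b) :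
    ∃ y ∈ insert z Y, HP F (insert z Y) y z := by
  induction Y using Finset.induction_on with
  | empty => exact ⟨z, by simp, HP.single z⟩
  | @insert a Y ha ih =>
    simp at hz
    obtain ⟨y, hy, hp⟩ := ih hz.2 (by
      intro b hb c hc hbc
      apply h _ _ _ _ hbc <;> simp at * <;> tauto)
    have hay : a ∉ insert z Y := by simp; exact ⟨fun e => hz.1 e.symm, ha⟩
    refine ⟨a, by simp, ?_⟩
    refine congr_set (HP.cons (h a (by simp) y ?_ ?_) hay hp) ?_
    · simp at hy ⊢; tauto
    · rintro rfl; exact hay hy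
    · ext; simp; tauto

end HP


section GoodSection

variable {V : Type} [DecidableEq V]

/-- Two disjoint paths covering `S` which join `{a, q}` to `{c, b}`. -/
def TP (F : SimpleGraph V) (S : Finset V) (a q c b : V) : Prop :=
  ∃ X Y, Disjoint X Y ∧ X ∪ Y = S ∧
    ((HP F X a c ∧ HP F Y q b) ∨ (HP F X a b ∧ HP F Y q c))

/-- `S` is good with respect to the vertex `c` and the end vertices `b`, `a`. -/
structure Good (F : SimpleGraph V) (c : V) (S : Finset V) (b a : V) : Prop where
  hr : HP F S c a
  hl : HP F S c b
  cr : ∀ q ∈ S, q ≠ a → TP F S a q c b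
  cl : ∀ q ∈ S, q ≠ b → TP F S b q c a

variable {F : SimpleGraph V} {c : V} {S : Finset V} {a b a' b' : V}

theorem Good.symm (h : Good F c S b a) : Good F c S a b := ⟨h.hl, h.hr, h.cl, h.cr⟩

theorem Good.base (c : V) : Good F c {c} c c := by
  refine ⟨HP.single c, HP.single c, ?_, ?_⟩ <;>
  · intro q hq hq'
    simp at hq; exact (hq' hq).elim

/-- extend the first path at the start and the second at its far end -/
theorem HP.snoc {X : Finset V} {x y z : V} (h : HP F X x y) (ha : F.Adj y z) (hz : z ∉ X) :
    HP F (insert z X) x z :=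
  ((h.join (HP.single z) ha (by simpa using hz))).congr_set (by ext; simp)

theorem Good.right (h : Good F c S b a) (ha' : a' ∉ S) (haa : F.Adj a a') {q0 : V} (hq0 : q0 ∈ S)
    (hq0a : q0 ≠ a) (hq : F.Adj a' q0) : Good F c (insert a' S) b a' := by
  have key : HP F (insert a' S) c b := by
    obtain ⟨X, Y, hd, hU, h1 | h1⟩ := h.cr q0 hq0 hq0a
    · have hX : a' ∉ X := fun e => ha' (hU ▸ Finset.mem_union_left _ e)
      have hY : a' ∉ Y := fun e => ha' (hU ▸ Finset.mem_union_right _ e)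
      have := (h1.1.rev.snoc haa hX).join h1.2 hq (by
        rw [Finset.disjoint_insert_left]; exact ⟨hY, hd⟩)
      exact this.congr_set (by rw [← hU]; ext; simp)
    · have hX : a' ∉ X := fun e => ha' (hU ▸ Finset.mem_union_left _ e)
      have hY : a' ∉ Y := fun e => ha' (hU ▸ Finset.mem_union_right _ e)
      have := (h1.2.rev.snoc hq.symm hY).join h1.1 haa.symm (by
        rw [Finset.disjoint_insert_left]; exact ⟨hX, hd.symm⟩)
      exact this.congr_set (by rw [← hU]; ext; simp; tauto)
  refine ⟨h.hr.snoc haa ha', key, ?_, ?_⟩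
  · intro q hqS hqa
    have hqS' : q ∈ S := by simpa [hqa] using hqS
    have aux : ∀ r, F.Adj r a' → ∀ s, TP F S r s c b → TP F (insert a' S) a' s c b := by
      rintro r hr s ⟨X, Y, hd, hU, h1⟩
      have hX : a' ∉ X := fun e => ha' (hU ▸ Finset.mem_union_left _ e)
      have hY : a' ∉ Y := fun e => ha' (hU ▸ Finset.mem_union_right _ e)
      refine ⟨insert a' X, Y, ?_, ?_, ?_⟩
      · rw [Finset.disjoint_insert_left]; exact ⟨hY, hd⟩
      · rw [← hU]; ext; simp
      · rcases h1 with h1 | h1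
        · exact Or.inl ⟨HP.cons hr.symm hX h1.1, h1.2⟩
        · exact Or.inr ⟨HP.cons hr.symm hX h1.1, h1.2⟩
    by_cases hqa2 : q = a
    · subst hqa2
      apply aux q0 hq.symm
      obtain ⟨X, Y, hd, hU, h1⟩ := h.cr q0 hq0 hq0a
      exact ⟨Y, X, hd.symm, by rw [Finset.union_comm]; exact hU, by tauto⟩
    · exact aux a haa q (h.cr q hqS' hqa2)
  · intro q hqS hqb
    by_cases hqa : q = a'
    · subst hqa
      refine ⟨S, {q}, by simpa using ha', by ext; simp, Or.inl ⟨h.hl.rev, HP.single q⟩⟩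
    · obtain ⟨X, Y, hd, hU, h1⟩ := h.cl q (by simpa [hqa] using hqS) hqb
      have hX : a' ∉ X := fun e => ha' (hU ▸ Finset.mem_union_left _ e)
      have hY : a' ∉ Y := fun e => ha' (hU ▸ Finset.mem_union_right _ e)
      rcases h1 with h1 | h1
      · refine ⟨X, insert a' Y, ?_, ?_, Or.inl ⟨h1.1, h1.2.snoc haa hY⟩⟩
        · rw [Finset.disjoint_insert_right]; exact ⟨hX, hd⟩
        · rw [← hU]; ext; simp
      · refine ⟨insert a' X, Y, ?_, ?_, Or.inr ⟨h1.1.snoc haa hX, h1.2⟩⟩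
        · rw [Finset.disjoint_insert_left]; exact ⟨hY, hd⟩
        · rw [← hU]; ext; simp

theorem Good.both_aux (h : Good F c S b a) (ha' : a' ∉ S) (hb' : b' ∉ S) (hab : a' ≠ b')
    (haa : F.Adj a a') (hbb : F.Adj b b') (hadj : F.Adj a' b') :
    HP F (insert a' (insert b' S)) c a' ∧
    ∀ q ∈ insert a' (insert b' S), q ≠ a' → TP F (insert a' (insert b' S)) a' q c b' := by
  constructor
  · exact (h.hl.snoc hbb hb').snoc hadj.symm (by simp [hab, ha'])
  · intro q hq hqa
    by_cases hqb : q = b'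
    · subst hqb
      refine ⟨insert a' S, {q}, ?_, ?_, Or.inl ⟨HP.cons haa.symm ha' h.hr.rev, HP.single q⟩⟩
      · simp [hb']; exact fun e => hab e.symm
      · ext; simp
    · have hqS : q ∈ S := by simpa [hqa, hqb] using hq
      by_cases hqa2 : q = a
      · subst hqa2
        refine ⟨{a', b'}, S, ?_, ?_, Or.inr ⟨HP.pair hadj, h.hr.rev⟩⟩
        · simp [ha', hb']
        · ext; simp
      · obtain ⟨X, Y, hd, hU, h1⟩ := h.cr q hqS hqa2
        have hX : a' ∉ X := fun e => ha' (hU ▸ Finset.mem_union_left _ e)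
        have hY : a' ∉ Y := fun e => ha' (hU ▸ Finset.mem_union_right _ e)
        have hX' : b' ∉ X := fun e => hb' (hU ▸ Finset.mem_union_left _ e)
        have hY' : b' ∉ Y := fun e => hb' (hU ▸ Finset.mem_union_right _ e)
        rcases h1 with h1 | h1
        · refine ⟨insert a' X, insert b' Y, ?_, ?_,
            Or.inl ⟨HP.cons haa.symm hX h1.1, h1.2.snoc hbb hY'⟩⟩
          · rw [Finset.disjoint_insert_left, Finset.disjoint_insert_right]
            simp [hY, hX', hd, hab]
          · rw [← hU]; ext; simp; tauto
        · refine ⟨insert b' (insert a' X), Y, ?_, ?_,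
            Or.inr ⟨(HP.cons haa.symm hX h1.1).snoc hbb (by simp [hX', Ne.symm hab]), h1.2⟩⟩
          · rw [Finset.disjoint_insert_left, Finset.disjoint_insert_left]
            simp [hY, hY', hd]
          · rw [← hU]; ext; simp; tauto

theorem Good.both (h : Good F c S b a) (ha' : a' ∉ S) (hb' : b' ∉ S) (hab : a' ≠ b')
    (haa : F.Adj a a') (hbb : F.Adj b b') (hadj : F.Adj a' b') :
    Good F c (insert a' (insert b' S)) b' a' := by
  have h1 := h.both_aux ha' hb' hab haa hbb hadj
  have h2 := h.symm.both_aux hb' ha' hab.symm hbb haa hadj.symm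
  rw [Finset.insert_comm] at h2
  exact ⟨h1.1, h2.1, h1.2, h2.2⟩

end GoodSection


section CycSection

variable {V : Type} [DecidableEq V]

/-- The vertices with index between `a` and `b`. -/
noncomputable def seg (u : ℤ → V) (a b : ℤ) : Finset V := (Finset.Icc a b).image u

theorem mem_seg {u : ℤ → V} {a b : ℤ} {x : V} : x ∈ seg u a b ↔ ∃ t, a ≤ t ∧ t ≤ b ∧ u t = x := by
  simp [seg, and_assoc]

/-- `u` parametrizes a closed cycle with `N` vertices whose edges are in `F`, and `F` has no longer
cycle. -/
structure Cy (F : SimpleGraph V) (u : ℤ → V) (N : ℤ) : Prop where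
  three : 3 ≤ N
  per : ∀ t, u (t + N) = u t
  inj : ∀ s t, s < t → t < s + N → u s ≠ u t
  adj : ∀ t, F.Adj (u t) (u (t + 1))
  hmax : ∀ X x y, HP F X x y → F.Adj y x → (X.card : ℤ) ≤ N

variable {F : SimpleGraph V} {u : ℤ → V} {N : ℤ}

theorem Cy.reflect (h : Cy F u N) : Cy F (fun t => u (-t)) N := by
  refine ⟨h.three, ?_, ?_, ?_, h.hmax⟩
  · intro t
    have := h.per (-(t + N))
    show u (-(t+N)) = u (-t)
    rw [← this]; congr 1; ring
  · intro s t h1 h2 e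
    exact h.inj (-t) (-s) (by omega) (by omega) e.symm
  · intro t
    have := (h.adj (-(t+1))).symm
    show F.Adj (u (-t)) (u (-(t+1)))
    convert this using 2
    ring

theorem Cy.shift (h : Cy F u N) (m : ℤ) : Cy F (fun t => u (t + m)) N := by
  refine ⟨h.three, ?_, ?_, ?_, h.hmax⟩
  · intro t
    have := h.per (t + m)
    show u (t + N + m) = u (t + m)
    rw [← this]; congr 1; ring
  · intro s t h1 h2 e
    exact h.inj (s+m) (t+m) (by omega) (by omega) e
  · intro t
    have := (h.adj (t+m))
    show F.Adj (u (t+m)) (u (t+1+m))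
    convert this using 2
    ring

theorem Cy.per_mul (h : Cy F u N) (t k : ℤ) : u (t + k * N) = u t := by
  induction k using Int.induction_on with
  | zero => simp
  | succ k ih =>
    rw [← ih, ← h.per (t + k * N)]; congr 1; ring
  | pred k ih =>
    rw [← ih, ← h.per (t + (-(k:ℤ) - 1) * N)]; congr 1; ring

/-- every vertex of the cycle has an index in a prescribed window -/
theorem Cy.window (h : Cy F u N) (t a : ℤ) : ∃ s, a ≤ s ∧ s < a + N ∧ u s = u t := by
  have hN := h.three
  refine ⟨a + (t - a) % N, ?_, ?_, ?_⟩
  · have := Int.emod_nonneg (t - a) (b := N) (by omega); omega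
  · have := Int.emod_lt_of_pos (t - a) (b := N) (by omega); omega
  · rw [← h.per_mul (a + (t - a) % N) ((t - a) / N)]
    congr 1
    have := Int.emod_add_mul_ediv (t - a) N
    linarith [mul_comm N ((t - a) / N)]

theorem Cy.inj' (h : Cy F u N) {s t : ℤ} (h1 : s < t + N) (h2 : t < s + N) (e : u s = u t) :
    s = t := by
  by_contra hne
  rcases lt_or_gt_of_ne hne with h3 | h3
  · exact h.inj s t h3 h2 e
  · exact h.inj t s h3 h1 e.symm

theorem Cy.seg_disj (h : Cy F u N) {a b c d : ℤ} (h1 : b < c) (h2 : d < a + N) :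
    Disjoint (seg u a b) (seg u c d) := by
  rw [Finset.disjoint_left]
  intro x hx hx'
  rw [mem_seg] at hx hx'
  obtain ⟨s, hs1, hs2, rfl⟩ := hx
  obtain ⟨t, ht1, ht2, e⟩ := hx'
  have := h.inj' (s := t) (t := s) (by omega) (by omega) e
  omega

theorem Cy.hp_seg (h : Cy F u N) {a b : ℤ} (h1 : a ≤ b) (h2 : b < a + N) :
    HP F (seg u a b) (u a) (u b) := by
  obtain ⟨k, rfl⟩ : ∃ k : ℕ, b = a + k := ⟨(b - a).toNat, by omega⟩
  clear h1
  induction k with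
  | zero => 
    refine (HP.single (u a)).congr_set ?_ |>.mono le_rfl |> fun h => by simpa using h
    simp [seg]
  | succ k ih =>
    have h3 := ih (by push_cast at h2; omega)
    have h4 := h3.snoc (z := u (a + (k+1 : ℕ))) (by
      have := h.adj (a + k); convert this using 2; push_cast; ring) (by
      intro e
      rw [mem_seg] at e
      obtain ⟨t, ht1, ht2, e⟩ := e
      have := h.inj' (by push_cast at *; omega) (by push_cast at *; omega) e
      push_cast at *; omega)
    refine h4.congr_set ?_
    ext x
    simp only [Finset.mem_insert, mem_seg]
    constructor
    · rintro (rfl | ⟨t, ht1, ht2, rfl⟩)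
      · exact ⟨_, by omega, le_rfl, rfl⟩
      · exact ⟨t, ht1, by push_cast; omega, rfl⟩
    · rintro ⟨t, ht1, ht2, rfl⟩
      by_cases ht : t ≤ a + k
      · exact Or.inr ⟨t, ht1, ht, rfl⟩
      · left; congr 1; push_cast at *; omega

theorem Cy.too_long (h : Cy F u N) {X : Finset V} {x y z : V} (hp : HP F X x y) (ha : F.Adj y x)
    (hz : z ∈ X) (hzC : ∀ t, u t ≠ z) (a : ℤ) (hX : ∀ t, a ≤ t → t < a + N → u t ∈ X) : False := by
  have h1 := h.hmax X x y hp ha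
  have hN := h.three
  have h2 : insert z (seg u a (a + N - 1)) ⊆ X := by
    intro v hv
    rw [Finset.mem_insert, mem_seg] at hv
    rcases hv with rfl | ⟨t, h3, h4, rfl⟩
    · exact hz
    · exact hX t h3 (by omega)
  have h3 := Finset.card_le_card h2
  rw [Finset.card_insert_of_notMem] at h3
  · have h4 : (seg u a (a+N-1)).card = N.toNat := by
      rw [seg, Finset.card_image_of_injOn]
      · simp
      · intro s hs t ht e
        simp at hs ht
        exact h.inj' (by omega) (by omega) e
    omega
  · rw [mem_seg]; rintro ⟨t, -, -, e⟩; exact hzC t e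

/-- Stages of the growth of the segment around `u 0`. -/
inductive Comp (F : SimpleGraph V) (u : ℤ → V) : ℤ → ℤ → Prop
  | base : Comp F u 0 0
  | right {i j t : ℤ} : Comp F u i j → -j ≤ t → t < i → F.Adj (u (i+1)) (u t) → Comp F u (i+1) j
  | left {i j t : ℤ} : Comp F u i j → -j < t → t ≤ i → F.Adj (u (-j-1)) (u t) → Comp F u i (j+1)
  | both {i j : ℤ} : Comp F u i j → F.Adj (u (i+1)) (u (-j-1)) → Comp F u (i+1) (j+1)

theorem Comp.nonneg {i j : ℤ} (h : Comp F u i j) : 0 ≤ i ∧ 0 ≤ j := by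
  induction h <;> omega

theorem Comp.reflect {i j : ℤ} (h : Comp F u i j) : Comp F (fun t => u (-t)) j i := by
  induction h with
  | base => exact Comp.base
  | @right i j t h1 h2 h3 h4 ih =>
    refine Comp.left (t := -t) ih (by omega) (by omega) ?_
    show F.Adj (u _) (u _)
    convert h4 using 2 <;> ring
  | @left i j t h1 h2 h3 h4 ih =>
    refine Comp.right (t := -t) ih (by omega) (by omega) ?_
    show F.Adj (u _) (u _)
    convert h4 using 2 <;> ring
  | @both i j h1 h4 ih =>
    refine Comp.both ih ?_
    show F.Adj (u _) (u _)
    convert h4.symm using 2 <;> ring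

theorem Comp.stage_right {i j : ℤ} (h : Comp F u i j) :
    ∀ t, 0 ≤ t → t ≤ i → ∃ j', j' ≤ j ∧ Comp F u t j' := by
  induction h with
  | base => intro t h1 h2; obtain rfl : t = 0 := by omega
            exact ⟨0, le_rfl, Comp.base⟩
  | @right i j s h1 h2 h3 h4 ih =>
    intro t ht1 ht2
    by_cases e : t = i + 1
    · subst e; exact ⟨j, le_rfl, Comp.right h1 h2 h3 h4⟩
    · exact ih t ht1 (by omega)
  | @left i j s h1 h2 h3 h4 ih =>
    intro t ht1 ht2
    obtain ⟨j', hj, hc⟩ := ih t ht1 ht2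
    exact ⟨j', by omega, hc⟩
  | @both i j h1 h4 ih =>
    intro t ht1 ht2
    by_cases e : t = i + 1
    · subst e; exact ⟨j+1, le_rfl, Comp.both h1 h4⟩
    · obtain ⟨j', hj, hc⟩ := ih t ht1 (by omega)
      exact ⟨j', by omega, hc⟩

theorem seg_insert_right {a b : ℤ} (h : a ≤ b + 1) : insert (u (b+1)) (seg u a b) = seg u a (b+1) := by
  ext x
  simp only [Finset.mem_insert, mem_seg]
  constructor
  · rintro (rfl | ⟨t, h1, h2, rfl⟩)
    · exact ⟨b+1, h, le_rfl, rfl⟩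
    · exact ⟨t, h1, by omega, rfl⟩
  · rintro ⟨t, h1, h2, rfl⟩
    by_cases e : t = b + 1
    · left; rw [e]
    · right; exact ⟨t, h1, by omega, rfl⟩

theorem seg_insert_left {a b : ℤ} (h : a - 1 ≤ b) : insert (u (a-1)) (seg u a b) = seg u (a-1) b := by
  ext x
  simp only [Finset.mem_insert, mem_seg]
  constructor
  · rintro (rfl | ⟨t, h1, h2, rfl⟩)
    · exact ⟨a-1, le_rfl, h, rfl⟩
    · exact ⟨t, by omega, h2, rfl⟩
  · rintro ⟨t, h1, h2, rfl⟩
    by_cases e : t = a - 1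
    · left; rw [e]
    · right; exact ⟨t, by omega, h2, rfl⟩

theorem Cy.notMem_seg (h : Cy F u N) {t a b : ℤ} (h1 : t < a ∨ b < t) (h2 : b < t + N)
    (h3 : t < a + N) : u t ∉ seg u a b := by
  rw [mem_seg]
  rintro ⟨s, hs1, hs2, e⟩
  have := h.inj' (by omega) (by omega) e
  omega

theorem Cy.adj_pred (h : Cy F u N) (t : ℤ) : F.Adj (u t) (u (t - 1)) := by
  have := (h.adj (t-1)).symm
  rwa [sub_add_cancel] at this

theorem Comp.good (h : Cy F u N) {i j : ℤ} (hc : Comp F u i j) (hij : i + j < N) :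
    Good F (u 0) (seg u (-j) i) (u (-j)) (u i) := by
  induction hc with
  | base => simpa [seg] using Good.base (F := F) (u 0)
  | @right i j t h1 h2 h3 h4 ih =>
    have hn := h1.nonneg
    have hg := ih (by omega)
    rw [← seg_insert_right (by omega)]
    refine hg.right (h.notMem_seg (by omega) (by omega) (by omega)) (h.adj i) (q0 := u t) 
      (mem_seg.2 ⟨t, h2, by omega, rfl⟩) (h.inj t i h3 (by omega)) h4
  | @left i j t h1 h2 h3 h4 ih =>
    have hn := h1.nonneg
    have hg := ih (by omega)
    have e : -(j+1) = -j - 1 := by ring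
    rw [e, ← seg_insert_left (by omega)]
    exact (hg.symm.right (h.notMem_seg (by omega) (by omega) (by omega)) (h.adj_pred _) (q0 := u t) 
      (mem_seg.2 ⟨t, by omega, h3, rfl⟩) (h.inj _ _ h2 (by omega)).symm h4).symm
  | @both i j h1 h4 ih =>
    have hn := h1.nonneg
    have hg := ih (by omega)
    have e : -(j+1) = -j - 1 := by ring
    rw [e, ← seg_insert_right (by omega), ← seg_insert_left (by omega)]
    exact hg.both (h.notMem_seg (by omega) (by omega) (by omega))
      (h.notMem_seg (by omega) (by omega) (by omega)) (h.inj _ _ (by omega) (by omega)).symm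
      (h.adj i) (h.adj_pred _) h4

end CycSection


section EarSection

variable {V : Type} [DecidableEq V]

/-- A longest cycle together with a path `z1 … zr` outside of it which joins `u 0` to `u m`. -/
structure Ear (F : SimpleGraph V) (u : ℤ → V) (N m : ℤ) (Z : Finset V) (z1 zr : V) : Prop where
  cy : Cy F u N
  mpos : 0 < m
  mlt : m < N
  hZ : HP F Z z1 zr
  disj : ∀ t, u t ∉ Z
  adj1 : F.Adj (u 0) z1
  adj2 : F.Adj zr (u m)

variable {F : SimpleGraph V} {u : ℤ → V} {N m : ℤ} {Z : Finset V} {z1 zr : V}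

theorem Ear.reflect (h : Ear F u N m Z z1 zr) : Ear F (fun t => u (-t)) N (N - m) Z z1 zr := by
  have h1 := h.mpos
  have h2 := h.mlt
  refine ⟨h.cy.reflect, by omega, by omega, h.hZ, fun t => h.disj _, by simpa using h.adj1, ?_⟩
  show F.Adj zr (u (-(N-m)))
  have h3 := h.adj2
  rw [← h.cy.per (-(N-m))]
  convert h3 using 2
  ring

theorem Ear.shift (h : Ear F u N m Z z1 zr) : Ear F (fun t => u (t + m)) N (N - m) Z zr z1 := by
  have h1 := h.mpos
  have h2 := h.mlt
  refine ⟨h.cy.shift m, by omega, by omega, h.hZ.rev, fun t => h.disj _, ?_, ?_⟩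
  · simpa using h.adj2.symm
  · show F.Adj z1 (u (N - m + m))
    have := h.cy.per 0
    rw [sub_add_cancel, ← zero_add N, this]
    exact h.adj1.symm

theorem Ear.Zdisj (h : Ear F u N m Z z1 zr) (a b : ℤ) : Disjoint Z (seg u a b) := by
  rw [Finset.disjoint_right]
  intro x hx
  obtain ⟨t, -, -, rfl⟩ := mem_seg.1 hx
  exact h.disj t

theorem Ear.z_ne (h : Ear F u N m Z z1 zr) (t : ℤ) : u t ≠ z1 := by
  intro e
  exact h.disj t (e ▸ h.hZ.left_mem)

theorem Cy.F1 (h : Cy F u N) {i j : ℤ} (hi : 0 ≤ i) (hj : 0 ≤ j)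
    (hg : Good F (u 0) (seg u (-j) i) (u (-j)) (u i)) (hij : i + j + 1 < N)
    {Z' : Finset V} {z y : V} (hp : HP F Z' z y) (hd : ∀ t, u t ∉ Z') (ha : F.Adj (u 0) z) :
    ¬ F.Adj y (u (i+1)) := by
  intro hy
  have hZd : ∀ a b, Disjoint (seg u a b) Z' := by
    intro a b
    rw [Finset.disjoint_left]
    intro x hx
    obtain ⟨t, -, -, rfl⟩ := mem_seg.1 hx
    exact hd t
  have p1 := hg.hl.rev.join hp ha (hZd _ _)
  have p2 := p1.join (h.hp_seg (a := i+1) (b := N-j-1) (by omega) (by omega)) hy (by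
    rw [Finset.disjoint_union_left]
    exact ⟨h.seg_disj (by omega) (by omega), (hZd _ _).symm⟩)
  refine h.too_long p2 ?_ (z := z) ?_ ?_ (-j) ?_
  · have := h.adj (N-j-1)
    rw [← h.per (-j)]
    convert this using 2; ring
  · simp [hp.left_mem]
  · intro t e; exact hd t (e ▸ hp.left_mem)
  · intro t h1 h2
    simp only [Finset.mem_union, mem_seg]
    by_cases h3 : t ≤ i
    · exact Or.inl (Or.inl ⟨t, h1, h3, rfl⟩)
    · exact Or.inr ⟨t, by omega, by omega, rfl⟩

/-- the path from `u m` through `T`, the arc behind `T`, and `S`, to `u 0` -/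
theorem Cy.arcpath (h : Cy F u N) {i j i' j' : ℤ} (hi : 0 ≤ i) (hj : 0 ≤ j) (hi' : 0 ≤ i')
    (hj' : 0 ≤ j') (h1 : i + j' < m) (h2 : i' + j < N - m)
    (hg : Good F (u 0) (seg u (-j) i) (u (-j)) (u i))
    (hg' : Good F (u m) (seg u (m-j') (m+i')) (u (m-j')) (u (m+i'))) :
    HP F (seg u (m-j') (m+i') ∪ seg u (m+i'+1) (N-j-1) ∪ seg u (-j) i) (u m) (u 0) := by
  have hST : Disjoint (seg u (m-j') (m+i')) (seg u (-j) i) := 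
    (h.seg_disj (by omega) (by omega)).symm
  have hend : F.Adj (u (N-j-1)) (u (-j)) := by
    have := h.adj (N-j-1)
    rw [← h.per (-j)]
    convert this using 2; ring
  by_cases hne : m + i' + 1 ≤ N - j - 1
  · have p1 := hg'.hr.join (h.hp_seg hne (by omega)) (h.adj _)
      (h.seg_disj (by omega) (by omega))
    refine p1.join hg.hl.rev hend ?_
    rw [Finset.disjoint_union_left]
    exact ⟨hST, (h.seg_disj (by omega) (by omega)).symm⟩
  · have e : seg u (m+i'+1) (N-j-1) = ∅ := by
      rw [seg, Finset.Icc_eq_empty hne, Finset.image_empty]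
    rw [e, Finset.union_empty]
    refine hg'.hr.join hg.hl.rev ?_ hST
    convert hend using 2; omega

theorem Ear.sepM (h : Ear F u N m Z z1 zr) {i j i' j' : ℤ} (hi : 0 ≤ i) (hj : 0 ≤ j) (hi' : 0 ≤ i')
    (hj' : 0 ≤ j') (h1 : i + j' < m) (h2 : i' + j < N - m)
    (hg : Good F (u 0) (seg u (-j) i) (u (-j)) (u i))
    (hg' : Good F (u m) (seg u (m-j') (m+i')) (u (m-j')) (u (m+i'))) : i + j' + 1 ≠ m := by
  intro hm
  have p := h.cy.arcpath hi hj hi' hj' h1 h2 hg hg'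
  have p2 := h.hZ.join p h.adj2 (by
    rw [Finset.disjoint_union_right, Finset.disjoint_union_right]
    exact ⟨⟨h.Zdisj _ _, h.Zdisj _ _⟩, h.Zdisj _ _⟩)
  refine h.cy.too_long p2 h.adj1 (z := z1) ?_ h.z_ne (-j) ?_
  · simp [h.hZ.left_mem]
  · intro t h3 h4
    simp only [Finset.mem_union, mem_seg]
    right
    by_cases h5 : t ≤ i
    · exact Or.inr ⟨t, h3, h5, rfl⟩
    · left
      by_cases h6 : t ≤ m + i'
      · exact Or.inl ⟨t, by omega, h6, rfl⟩
      · exact Or.inr ⟨t, by omega, by omega, rfl⟩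

theorem Ear.F2 (h : Ear F u N m Z z1 zr) {i j i' j' : ℤ} (hi : 0 ≤ i) (hj : 0 ≤ j) (hi' : 0 ≤ i')
    (hj' : 0 ≤ j') (h1 : i + j' + 1 < m) (h2 : i' + j + 1 < N - m)
    (hg : Good F (u 0) (seg u (-j) i) (u (-j)) (u i))
    (hg' : Good F (u m) (seg u (m-j') (m+i')) (u (m-j')) (u (m+i'))) :
    ¬ F.Adj (u (i+1)) (u (m+i'+1)) := by
  intro ha
  have hc := h.cy
  have hend : F.Adj (u (N-j-1)) (u (-j)) := by
    have := hc.adj (N-j-1)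
    rw [← hc.per (-j)]
    convert this using 2; ring
  have p1 := h.hZ.join hg'.hl h.adj2 (h.Zdisj _ _)
  have p2 := p1.join (hc.hp_seg (a := i+1) (b := m-j'-1) (by omega) (by omega)).rev
    (hc.adj_pred _) (by
      rw [Finset.disjoint_union_left]
      exact ⟨h.Zdisj _ _, (hc.seg_disj (by omega) (by omega)).symm⟩)
  have p3 := p2.join (hc.hp_seg (a := m+i'+1) (b := N-j-1) (by omega) (by omega)) ha (by
      rw [Finset.disjoint_union_left, Finset.disjoint_union_left]
      exact ⟨⟨h.Zdisj _ _, (hc.seg_disj (by omega) (by omega))⟩,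
        (hc.seg_disj (by omega) (by omega))⟩)
  have p4 := p3.join hg.hl.rev hend (by
      rw [Finset.disjoint_union_left, Finset.disjoint_union_left, Finset.disjoint_union_left]
      exact ⟨⟨⟨h.Zdisj _ _, (hc.seg_disj (by omega) (by omega)).symm⟩,
        (hc.seg_disj (by omega) (by omega)).symm⟩, (hc.seg_disj (by omega) (by omega)).symm⟩)
  refine hc.too_long p4 h.adj1 (z := z1) ?_ h.z_ne (-j) ?_
  · simp [h.hZ.left_mem]
  · intro t h3 h4
    simp only [Finset.mem_union, mem_seg]
    by_cases h5 : t ≤ i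
    · exact Or.inr ⟨t, h3, h5, rfl⟩
    · left
      by_cases h6 : m + i' < t
      · exact Or.inr ⟨t, by omega, by omega, rfl⟩
      · left
        by_cases h7 : t < m - j'
        · exact Or.inr ⟨t, by omega, by omega, rfl⟩
        · exact Or.inl (Or.inr ⟨t, by omega, by omega, rfl⟩)

theorem Ear.F4 (h : Ear F u N m Z z1 zr) {i j : ℤ} (hi : 0 ≤ i) (hj : 0 ≤ j)
    (h1 : i + 1 < m) (h2 : j + 1 < N - m)
    (hg : Good F (u 0) (seg u (-j) i) (u (-j)) (u i))
    (hv : F.Adj (u (m-1)) (u (m+1))) :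
    ¬ F.Adj (u (i+1)) (u m) := by
  intro ha
  have hc := h.cy
  have hend : F.Adj (u (N-j-1)) (u (-j)) := by
    have := hc.adj (N-j-1)
    rw [← hc.per (-j)]
    convert this using 2; ring
  have p1 := h.hZ.join (hc.hp_seg (a := m) (b := m) (by omega) (by omega)) h.adj2 (h.Zdisj _ _)
  have p2 := p1.join (hc.hp_seg (a := i+1) (b := m-1) (by omega) (by omega))
    ha.symm (by
      rw [Finset.disjoint_union_left]
      exact ⟨h.Zdisj _ _, (hc.seg_disj (by omega) (by omega)).symm⟩)
  have p3 := p2.join (hc.hp_seg (a := m+1) (b := N-j-1) (by omega) (by omega)) hv (by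
      rw [Finset.disjoint_union_left, Finset.disjoint_union_left]
      exact ⟨⟨h.Zdisj _ _, (hc.seg_disj (by omega) (by omega))⟩,
        (hc.seg_disj (by omega) (by omega))⟩)
  have p4 := p3.join hg.hl.rev hend (by
      rw [Finset.disjoint_union_left, Finset.disjoint_union_left, Finset.disjoint_union_left]
      exact ⟨⟨⟨h.Zdisj _ _, (hc.seg_disj (by omega) (by omega)).symm⟩,
        (hc.seg_disj (by omega) (by omega)).symm⟩, (hc.seg_disj (by omega) (by omega)).symm⟩)
  refine hc.too_long p4 h.adj1 (z := z1) ?_ h.z_ne (-j) ?_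
  · simp [h.hZ.left_mem]
  · intro t h3 h4
    simp only [Finset.mem_union, mem_seg]
    by_cases h5 : t ≤ i
    · exact Or.inr ⟨t, h3, h5, rfl⟩
    · left
      by_cases h6 : m < t
      · exact Or.inr ⟨t, by omega, by omega, rfl⟩
      · left
        by_cases h7 : t < m
        · exact Or.inr ⟨t, by omega, by omega, rfl⟩
        · exact Or.inl (Or.inr ⟨t, by omega, by omega, rfl⟩)

end EarSection


section SepSection

variable {V : Type} [DecidableEq V]
variable {F : SimpleGraph V} {u : ℤ → V} {N m : ℤ} {Z : Finset V} {z1 zr : V}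

theorem seg_shift (u : ℤ → V) (a b m : ℤ) : seg (fun t => u (t + m)) a b = seg u (a + m) (b + m) := by
  ext x
  simp only [mem_seg]
  constructor
  · rintro ⟨t, h1, h2, rfl⟩
    exact ⟨t + m, by omega, by omega, rfl⟩
  · rintro ⟨t, h1, h2, rfl⟩
    exact ⟨t - m, by omega, by omega, by simp⟩

theorem Cy.good_shift (h : Cy F u N) {i j : ℤ} (hc : Comp F (fun t => u (t + m)) i j) (hij : i + j < N) :
    Good F (u m) (seg u (m-j) (m+i)) (u (m-j)) (u (m+i)) := by
  have := Comp.good (h.shift m) hc hij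
  rw [seg_shift] at this
  simp only [zero_add] at this
  rwa [show -j + m = m - j by ring, show i + m = m + i by ring] at this

theorem Ear.reflect_shift (h : Ear F u N m Z z1 zr) :
    (fun t => (fun s => u (-s)) (t + (N - m))) = (fun t => (fun s => u (s + m)) (-t)) := by
  funext t
  show u (-(t + (N-m))) = u (-t + m)
  rw [← h.cy.per (-(t + (N-m)))]
  congr 1; ring

theorem Ear.compReflect (h : Ear F u N m Z z1 zr) {i j : ℤ} (hc : Comp F (fun t => u (t + m)) i j) :
    Comp F (fun t => (fun s => u (-s)) (t + (N - m))) j i := by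
  rw [h.reflect_shift]
  exact hc.reflect

theorem Ear.sepStep (h : Ear F u N m Z z1 zr) {i j i' j' : ℤ} (hc : Comp F u i j)
    (hc' : Comp F (fun t => u (t + m)) i' j') (h1 : i + j' < m) (h2 : i' + j < N - m) :
    i + j' + 1 < m ∧ i' + j + 1 < N - m := by
  obtain ⟨hi, hj⟩ := hc.nonneg
  obtain ⟨hi', hj'⟩ := hc'.nonneg
  have a1 := h.sepM hi hj hi' hj' h1 h2 (Comp.good h.cy hc (by omega)) (h.cy.good_shift hc' (by omega))
  have hr := h.reflect
  have a2 := hr.sepM hj hi hj' hi' (by omega) (by omega) (Comp.good hr.cy hc.reflect (by omega))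
    (hr.cy.good_shift (h.compReflect hc') (by omega))
  omega

theorem Ear.sep (h : Ear F u N m Z z1 zr) {i j i' j' : ℤ} (hc : Comp F u i j)
    (hc' : Comp F (fun t => u (t + m)) i' j') : i + j' + 1 < m ∧ i' + j + 1 < N - m := by
  have hm := h.mpos
  have hm' := h.mlt
  revert i' j'
  induction hc with
  | base =>
    intro i' j' hc'
    induction hc' with
    | base => exact h.sepStep Comp.base Comp.base (by omega) (by omega)
    | right h1 h2 h3 h4 ih => exact h.sepStep Comp.base (Comp.right h1 h2 h3 h4) (by omega) (by omega)
    | left h1 h2 h3 h4 ih => exact h.sepStep Comp.base (Comp.left h1 h2 h3 h4) (by omega) (by omega)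
    | both h1 h2 ih => exact h.sepStep Comp.base (Comp.both h1 h2) (by omega) (by omega)
  | right h1 h2 h3 h4 ih =>
    intro i' j' hc'
    have := ih hc'
    exact h.sepStep (Comp.right h1 h2 h3 h4) hc' (by omega) (by omega)
  | left h1 h2 h3 h4 ih =>
    intro i' j' hc'
    have := ih hc'
    exact h.sepStep (Comp.left h1 h2 h3 h4) hc' (by omega) (by omega)
  | both h1 h2 ih =>
    intro i' j' hc'
    have := ih hc'
    exact h.sepStep (Comp.both h1 h2) hc' (by omega) (by omega)

/-- a path off the cycle starting at a neighbour of `u 0` -/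
def Off (F : SimpleGraph V) (u : ℤ → V) (y : V) : Prop :=
  ∃ Z' z, HP F Z' z y ∧ (∀ t, u t ∉ Z') ∧ F.Adj (u 0) z

theorem Off.reflect {y : V} (h : Off F u y) : Off F (fun t => u (-t)) y := by
  obtain ⟨Z', z, h1, h2, h3⟩ := h
  exact ⟨Z', z, h1, fun t => h2 _, by simpa using h3⟩

theorem Ear.N1 (h : Ear F u N m Z z1 zr) {i j : ℤ} (hc : Comp F u i j) {y : V} (hy : Off F u y)
    {t : ℤ} (h1 : 1 ≤ t) (h2 : t ≤ i + 1) : ¬ F.Adj y (u t) := by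
  have hs := h.sep hc Comp.base
  obtain ⟨j', hj', hc1⟩ := hc.stage_right (t-1) (by omega) (by omega)
  obtain ⟨hi0, hj0⟩ := hc1.nonneg
  obtain ⟨Z', z, a1, a2, a3⟩ := hy
  have := h.cy.F1 hi0 hj0 (Comp.good h.cy hc1 (by omega)) (by omega) a1 a2 a3
  rwa [sub_add_cancel] at this

theorem Ear.N2 (h : Ear F u N m Z z1 zr) {i j : ℤ} (hc : Comp F u i j)
    (hv : F.Adj (u (m-1)) (u (m+1)))
    {t : ℤ} (h1 : 1 ≤ t) (h2 : t ≤ i + 1) : ¬ F.Adj (u t) (u m) := by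
  have hs := h.sep hc Comp.base
  obtain ⟨j', hj', hc1⟩ := hc.stage_right (t-1) (by omega) (by omega)
  obtain ⟨hi0, hj0⟩ := hc1.nonneg
  have := h.F4 hi0 hj0 (by omega) (by omega) (Comp.good h.cy hc1 (by omega)) hv
  rwa [sub_add_cancel] at this

theorem Ear.N3 (h : Ear F u N m Z z1 zr) {i j i' j' : ℤ} (hc : Comp F u i j)
    (hc' : Comp F (fun t => u (t + m)) i' j')
    {t s : ℤ} (h1 : 1 ≤ t) (h2 : t ≤ i + 1) (h3 : 1 ≤ s) (h4 : s ≤ i' + 1) :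
    ¬ F.Adj (u t) (u (m + s)) := by
  have hs := h.sep hc hc'
  obtain ⟨j1, hj1, hc1⟩ := hc.stage_right (t-1) (by omega) (by omega)
  obtain ⟨hi0, hj0⟩ := hc1.nonneg
  obtain ⟨j2, hj2, hc2⟩ := hc'.stage_right (s-1) (by omega) (by omega)
  obtain ⟨hi0', hj0'⟩ := hc2.nonneg
  have := h.F2 hi0 hj0 hi0' hj0' (by omega) (by omega) (Comp.good h.cy hc1 (by omega))
    (h.cy.good_shift hc2 (by omega))
  rw [sub_add_cancel] at this
  convert this using 3
  ring

/-- two-sided version of `N1` -/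
theorem Ear.N1' (h : Ear F u N m Z z1 zr) {i j : ℤ} (hc : Comp F u i j) {y : V} (hy : Off F u y)
    {t : ℤ} (h0 : t ≠ 0) (h1 : -(j+1) ≤ t) (h2 : t ≤ i + 1) : ¬ F.Adj y (u t) := by
  rcases lt_or_gt_of_ne h0 with h3 | h3
  · have := h.reflect.N1 hc.reflect hy.reflect (t := -t) (by omega) (by omega)
    simpa using this
  · exact h.N1 hc hy (by omega) h2

theorem Ear.N2' (h : Ear F u N m Z z1 zr) {i j : ℤ} (hc : Comp F u i j)
    (hv : F.Adj (u (m-1)) (u (m+1)))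
    {t : ℤ} (h0 : t ≠ 0) (h1 : -(j+1) ≤ t) (h2 : t ≤ i + 1) : ¬ F.Adj (u t) (u m) := by
  rcases lt_or_gt_of_ne h0 with h3 | h3
  · have key : ∀ s, u (-(N - m + s)) = u (m - s) := by
      intro s
      rw [← h.cy.per (-(N-m+s))]; congr 1; ring
    have := h.reflect.N2 hc.reflect (t := -t) (by
      have k1 := key (-1)
      have k2 := key 1
      rw [sub_neg_eq_add] at k1
      show F.Adj (u (-(N - m + -1))) (u (-(N-m+1)))
      rw [k1, k2]; exact hv.symm) (by omega) (by omega)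
    have k := key 0
    simp only [add_zero, sub_zero] at k
    simp only [neg_neg] at this
    rwa [k] at this
  · exact h.N2 hc hv (by omega) h2

theorem Ear.N3' (h : Ear F u N m Z z1 zr) {i j i' j' : ℤ} (hc : Comp F u i j)
    (hc' : Comp F (fun t => u (t + m)) i' j')
    {t s : ℤ} (h1 : 1 ≤ t) (h2 : t ≤ j + 1) (h3 : 1 ≤ s) (h4 : s ≤ j' + 1) :
    ¬ F.Adj (u (-t)) (u (m - s)) := by
  have := h.reflect.N3 hc.reflect (h.compReflect hc') h1 h2 h3 h4
  have key : ∀ s, u (-(N - m + s)) = u (m - s) := by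
      intro s
      rw [← h.cy.per (-(N-m+s))]; congr 1; ring
  simp only [key] at this
  exact this

theorem Ear.exists_max (h : Ear F u N m Z z1 zr) {i0 j0 : ℤ} (hc0 : Comp F u i0 j0) :
    ∃ i j, Comp F u i j ∧ i0 ≤ i ∧ j0 ≤ j ∧
      ∀ i' j', i ≤ i' → j ≤ j' → Comp F u i' j' → i' + j' ≤ i + j := by
  have hb : ∀ k : ℕ, ∀ i0 j0, Comp F u i0 j0 → N - (i0 + j0) ≤ k →
     ∃ i j, Comp F u i j ∧ i0 ≤ i ∧ j0 ≤ j ∧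
      ∀ i' j', i ≤ i' → j ≤ j' → Comp F u i' j' → i' + j' ≤ i + j := by
    intro k
    induction k with
    | zero =>
      intro i0 j0 hc hk
      have := h.sep hc Comp.base
      omega
    | succ k ih =>
      intro i0 j0 hc hk
      by_cases hm : ∀ i' j', i0 ≤ i' → j0 ≤ j' → Comp F u i' j' → i' + j' ≤ i0 + j0
      · exact ⟨i0, j0, hc, le_rfl, le_rfl, hm⟩
      · push Not at hm
        obtain ⟨i', j', h0, h0', h1, h2⟩ := hm
        obtain ⟨i, j, h3, h4, h4', h5⟩ := ih i' j' h1 (by push_cast at hk; omega)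
        exact ⟨i, j, h3, by omega, by omega, h5⟩
  exact hb (N - (i0+j0)).toNat i0 j0 hc0 (by omega)

end SepSection


section NSection

variable {V : Type}

/-- no induced claw has two end vertices with property `L` -/
def ClawLt (G : SimpleGraph V) (L : V → Prop) : Prop :=
  ∀ c x y w, G.Adj c x → G.Adj c y → G.Adj c w → x ≠ y → x ≠ w → y ≠ w →
    ¬ G.Adj x y → ¬ G.Adj x w → ¬ G.Adj y w → L x → L y → False

/-- no induced wounded has two vertices at distance two with property `L` -/
def WLt (G : SimpleGraph V) (L : V → Prop) : Prop :=
  ∀ v0 v1 v2 v3 v4 v5, G.Adj v0 v1 → G.Adj v1 v2 → G.Adj v0 v2 → G.Adj v0 v3 → G.Adj v1 v4 →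
    G.Adj v4 v5 → ¬ G.Adj v0 v4 → ¬ G.Adj v0 v5 → ¬ G.Adj v1 v3 → ¬ G.Adj v1 v5 →
    ¬ G.Adj v2 v3 → ¬ G.Adj v2 v4 → ¬ G.Adj v2 v5 → ¬ G.Adj v3 v4 → ¬ G.Adj v3 v5 →
    ¬ (L v0 ∧ L v4) ∧ ¬ (L v4 ∧ L v2) ∧ ¬ (L v2 ∧ L v3)

theorem dist_two {W : Type} {R : SimpleGraph W} {a b c : W} (h : a ≠ b) (h1 : ¬ R.Adj a b)
    (h2 : R.Adj a c) (h3 : R.Adj c b) : R.dist a b = 2 := by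
  have hle : R.dist a b ≤ 2 := by
    have := SimpleGraph.dist_le (SimpleGraph.Walk.cons h2 (SimpleGraph.Walk.cons h3 SimpleGraph.Walk.nil))
    simpa using this
  have hr : R.Reachable a b := ⟨SimpleGraph.Walk.cons h2 (SimpleGraph.Walk.cons h3 SimpleGraph.Walk.nil)⟩
  have h0 := hr.pos_dist_of_ne h
  have h4 : R.dist a b ≠ 1 := fun e => h1 (SimpleGraph.dist_eq_one_iff_adj.1 e)
  omega

theorem clawLt_of [Fintype V] (G : SimpleGraph V) [DecidableRel G.Adj] (h : FHeavy G claw) :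
    ClawLt G (fun v => ¬ Fintype.card V ≤ 2 * G.degree v) := by
  intro c x y w h1 h2 h3 h4 h5 h6 h7 h8 h9 lx ly
  let f : Fin 4 → V := ![c, x, y, w]
  have hf : ∀ a b : Fin 4, G.Adj (f a) (f b) ↔ claw.Adj a b := by
    intro a b
    have h7' : ¬ G.Adj y x := fun e => h7 e.symm
    have h8' : ¬ G.Adj w x := fun e => h8 e.symm
    have h9' : ¬ G.Adj w y := fun e => h9 e.symm
    fin_cases a <;> fin_cases b <;>
      simp [f, claw, h1, h2, h3, h1.symm, h2.symm, h3.symm, h7, h8, h9, h7', h8', h9']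
  have hinj : Function.Injective f := by
    intro a b hab
    fin_cases a <;> fin_cases b <;>
      simp [f, h1.ne, h2.ne, h3.ne, h1.ne', h2.ne', h3.ne', h4, h5, h6, h4.symm, h5.symm,
        h6.symm] at hab ⊢
  have hd : claw.dist 1 2 = 2 := by
    apply dist_two (c := 0) <;> simp [claw]
  have := h ⟨⟨f, hinj⟩, fun {a b} => hf a b⟩ 1 2 hd
  have e : Fintype.card V ≤ 2 * max (G.degree x) (G.degree y) := this
  rcases max_cases (G.degree x) (G.degree y) with ⟨e1, -⟩ | ⟨e1, -⟩ <;> rw [e1] at e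
  · exact lx e
  · exact ly e

theorem wLt_of [Fintype V] (G : SimpleGraph V) [DecidableRel G.Adj] (h : FHeavy G woundedGraph) :
    WLt G (fun v => ¬ Fintype.card V ≤ 2 * G.degree v) := by
  intro v0 v1 v2 v3 v4 v5 a01 a12 a02 a03 a14 a45 n04 n05 n13 n15 n23 n24 n25 n34 n35
  let f : Fin 6 → V := ![v0, v1, v2, v3, v4, v5]
  have s01 := a01.symm
  have s12 := a12.symm
  have s02 := a02.symm
  have s03 := a03.symm
  have s14 := a14.symm
  have s45 := a45.symm
  have m04 : ¬ G.Adj v4 v0 := fun e => n04 e.symm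
  have m05 : ¬ G.Adj v5 v0 := fun e => n05 e.symm
  have m13 : ¬ G.Adj v3 v1 := fun e => n13 e.symm
  have m15 : ¬ G.Adj v5 v1 := fun e => n15 e.symm
  have m23 : ¬ G.Adj v3 v2 := fun e => n23 e.symm
  have m24 : ¬ G.Adj v4 v2 := fun e => n24 e.symm
  have m25 : ¬ G.Adj v5 v2 := fun e => n25 e.symm
  have m34 : ¬ G.Adj v4 v3 := fun e => n34 e.symm
  have m35 : ¬ G.Adj v5 v3 := fun e => n35 e.symm
  have hf : ∀ a b : Fin 6, G.Adj (f a) (f b) ↔ woundedGraph.Adj a b := by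
    intro a b
    fin_cases a <;> fin_cases b <;>
      simp [f, woundedGraph, *]
  have hinj : Function.Injective f := by
    have d01 := a01.ne
    have d12 := a12.ne
    have d02 := a02.ne
    have d03 := a03.ne
    have d14 := a14.ne
    have d45 := a45.ne
    have d04 : v0 ≠ v4 := by rintro rfl; exact n34 a03.symm
    have d05 : v0 ≠ v5 := by rintro rfl; exact n15 s01
    have d13 : v1 ≠ v3 := by rintro rfl; exact n23 s12
    have d15 : v1 ≠ v5 := by rintro rfl; exact n05 a01
    have d23 : v2 ≠ v3 := by rintro rfl; exact n13 a12
    have d24 : v2 ≠ v4 := by rintro rfl; exact n04 a02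
    have d25 : v2 ≠ v5 := by rintro rfl; exact n05 a02
    have d34 : v3 ≠ v4 := by rintro rfl; exact n04 a03
    have d35 : v3 ≠ v5 := by rintro rfl; exact n05 a03
    intro a b hab
    fin_cases a <;> fin_cases b <;>
      simp only [f, Fin.isValue, Fin.zero_eta, Fin.mk_one, Fin.reduceFinMk, Matrix.cons_val] at hab ⊢ <;>
      first
        | rfl
        | (exfalso; first | exact d01 hab | exact d12 hab | exact d02 hab | exact d03 hab |
            exact d14 hab | exact d45 hab | exact d04 hab | exact d05 hab | exact d13 hab |
            exact d15 hab | exact d23 hab | exact d24 hab | exact d25 hab | exact d34 hab |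
            exact d35 hab | exact d01 hab.symm | exact d12 hab.symm | exact d02 hab.symm |
            exact d03 hab.symm | exact d14 hab.symm | exact d45 hab.symm | exact d04 hab.symm |
            exact d05 hab.symm | exact d13 hab.symm | exact d15 hab.symm | exact d23 hab.symm |
            exact d24 hab.symm | exact d25 hab.symm | exact d34 hab.symm | exact d35 hab.symm)
  have key : ∀ a b : Fin 6, woundedGraph.dist a b = 2 →
      ¬ ((¬ Fintype.card V ≤ 2 * G.degree (f a)) ∧ ¬ Fintype.card V ≤ 2 * G.degree (f b)) := by
    intro a b hd ⟨lx, ly⟩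
    have e : Fintype.card V ≤ 2 * max (G.degree (f a)) (G.degree (f b)) :=
      h ⟨⟨f, hinj⟩, fun {a b} => hf a b⟩ a b hd
    rcases max_cases (G.degree (f a)) (G.degree (f b)) with ⟨e1, -⟩ | ⟨e1, -⟩ <;> rw [e1] at e
    · exact lx e
    · exact ly e
  refine ⟨key 0 4 ?_, key 4 2 ?_, key 2 3 ?_⟩
  · apply dist_two (c := 1) <;> simp [woundedGraph]
  · apply dist_two (c := 1) <;> simp [woundedGraph]
  · apply dist_two (c := 0) <;> simp [woundedGraph]

/-- A sequence of vertices in `S` from a vertex in `A` to `z`. -/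
structure Ch (G : SimpleGraph V) (A S : V → Prop) (z : V) (m : ℕ) (f : ℕ → V) : Prop where
  start : A (f 0)
  fin : f m = z
  ins : ∀ k, k ≤ m → S (f k)
  adj : ∀ k, k < m → G.Adj (f k) (f (k+1))

variable {G : SimpleGraph V} {A S L : V → Prop} {z : V} {m : ℕ} {f : ℕ → V}

theorem Ch.exists_min (h : ∃ m f, Ch G A S z m f) :
    ∃ m f, Ch G A S z m f ∧ ∀ m' f', Ch G A S z m' f' → m ≤ m' := by
  classical
  refine ⟨Nat.find h, (Nat.find_spec h).choose, (Nat.find_spec h).choose_spec, ?_⟩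
  intro m' f' h'
  exact Nat.find_min' h ⟨f', h'⟩

theorem Ch.chord (h : Ch G A S z m f) (hm : ∀ m' f', Ch G A S z m' f' → m ≤ m') {a b : ℕ}
    (hab : a < b) (hb : b ≤ m) (hadj : G.Adj (f a) (f b)) : b = a + 1 := by
  by_contra hne
  have := hm (m - (b - a - 1)) (fun k => if k ≤ a then f k else f (k + (b - a - 1))) ⟨by
      simpa using h.start, by
      show (if m - (b - a - 1) ≤ a then f (m - (b-a-1)) else f (m - (b-a-1) + (b-a-1))) = z
      rw [if_neg (by omega), show m - (b-a-1) + (b-a-1) = m by omega]; exact h.fin, by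
      intro k hk
      show S (if k ≤ a then f k else f (k + (b-a-1)))
      split_ifs
      · exact h.ins _ (by omega)
      · exact h.ins _ (by omega), by
      intro k hk
      show G.Adj (if k ≤ a then f k else f (k + (b-a-1)))
        (if k + 1 ≤ a then f (k+1) else f (k + 1 + (b-a-1)))
      rcases lt_trichotomy k a with h1 | h1 | h1
      · rw [if_pos (by omega), if_pos (by omega)]; exact h.adj _ (by omega)
      · subst h1
        rw [if_pos le_rfl, if_neg (by omega), show k + 1 + (b-k-1) = b by omega]; exact hadj
      · rw [if_neg (by omega), if_neg (by omega)]
        have := h.adj (k + (b-a-1)) (by omega)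
        rwa [show k + (b-a-1) + 1 = k + 1 + (b-a-1) by omega] at this⟩
  omega

theorem Ch.inj (h : Ch G A S z m f) (hm : ∀ m' f', Ch G A S z m' f' → m ≤ m') {a b : ℕ}
    (hab : a < b) (hb : b ≤ m) : f a ≠ f b := by
  intro e
  by_cases h1 : b = m
  · have := hm a f ⟨h.start, by rw [e, h1, h.fin], fun k hk => h.ins k (by omega),
      fun k hk => h.adj k (by omega)⟩
    omega
  · have h2 := h.adj b (by omega)
    rw [← e] at h2
    have := h.chord hm (by omega) (by omega) h2
    omega

theorem Ch.notA (h : Ch G A S z m f) (hm : ∀ m' f', Ch G A S z m' f' → m ≤ m') {k : ℕ}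
    (hk : 1 ≤ k) (hk' : k ≤ m) : ¬ A (f k) := by
  intro e
  have := hm (m - k) (fun j => f (j + k)) ⟨by simpa using e, by
    show f (m - k + k) = z
    rw [Nat.sub_add_cancel hk', h.fin], fun j hj => h.ins _ (by omega), fun j hj => by
      have := h.adj (j+k) (by omega)
      rwa [show j + k + 1 = j + 1 + k by omega] at this⟩
  omega

theorem Ch.notAdj (h : Ch G A S z m f) (hm : ∀ m' f', Ch G A S z m' f' → m ≤ m') {k : ℕ}
    (hk : 2 ≤ k) (hk' : k ≤ m) {x : V} (hx : A x) (hxS : S x) : ¬ G.Adj x (f k) := by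
  intro e
  have := hm (m - k + 1) (fun j => if j = 0 then x else f (j + k - 1)) ⟨by simpa using hx, by
    show (if m - k + 1 = 0 then x else f (m - k + 1 + k - 1)) = z
    rw [if_neg (by omega), show m - k + 1 + k - 1 = m by omega, h.fin], fun j hj => by
      show S (if j = 0 then x else f (j + k - 1))
      split_ifs
      · exact hxS
      · exact h.ins _ (by omega), fun j hj => by
      show G.Adj (if j = 0 then x else f (j+k-1)) (if j + 1 = 0 then x else f (j+1+k-1))
      rw [if_neg (by omega : ¬ (j + 1 = 0))]
      split_ifs with h0
      · subst h0; rwa [show 0 + 1 + k - 1 = k by omega]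
      · have := h.adj (j+k-1) (by omega)
        rwa [show j + k - 1 + 1 = j + 1 + k - 1 by omega] at this⟩
  omega

theorem net_lemma {Γ Λ : V → Prop} (hcl : ClawLt G L) (hw : WLt G L) {l1 l2 l3 n1 n2 n3 : V}
    (hΛΓ : ∀ v, Λ v → Γ v) (hL : ∀ v, Λ v → L v) (h12 : l1 ≠ l2)
    (hl3 : ¬ Λ l3) (u1 : ∀ x, Γ x → G.Adj l1 x → x = n1) (u2 : ∀ x, Γ x → G.Adj l2 x → x = n2)
    (u3 : ∀ x, Γ x → G.Adj l3 x → x = n3) (a12 : ¬ G.Adj l1 l2) (a13 : ¬ G.Adj l1 l3)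
    (a23 : ¬ G.Adj l2 l3) (c12 : ∃ m f, Ch G (fun x => x = l1) Λ l2 m f)
    (c3 : ∃ m f, Ch G (fun x => x = l1) Γ l3 m f) : G.Adj n1 n2 ∧ G.Adj n1 n3 ∧ G.Adj n2 n3 := by
  obtain ⟨m, p, hp, hpm⟩ := Ch.exists_min c12
  have hl1 : Λ l1 := by have := hp.ins 0 (by omega); rwa [hp.start] at this
  obtain ⟨D, y, hy, hym⟩ := Ch.exists_min (G := G) (A := fun x => ∃ k, k ≤ m ∧ p k = x) (S := Γ) (z := l3) (by
    obtain ⟨m', f', h'⟩ := c3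
    exact ⟨m', f', ⟨⟨0, by omega, by rw [h'.start]; exact hp.start⟩, h'.fin, h'.ins, h'.adj⟩⟩)
  have p0 : p 0 = l1 := hp.start
  have pm : p m = l2 := hp.fin
  have hLp : ∀ k, k ≤ m → L (p k) := fun k hk => hL _ (hp.ins k hk)
  have hΓp : ∀ k, k ≤ m → Γ (p k) := fun k hk => hΛΓ _ (hp.ins k hk)
  have hm0 : m ≠ 0 := by rintro rfl; exact h12 (p0.symm.trans pm)
  have hm1 : m ≠ 1 := by
    rintro rfl
    have := hp.adj 0 (by omega)
    rw [p0, zero_add, pm] at this; exact a12 this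
  have p1 : p 1 = n1 := u1 _ (hΓp _ (by omega)) (by have := hp.adj 0 (by omega); rwa [p0] at this)
  have pm1 : p (m-1) = n2 := u2 _ (hΓp _ (by omega)) (by
    have := hp.adj (m-1) (by omega)
    rw [show m - 1 + 1 = m by omega, pm] at this; exact this.symm)
  have hD0 : D ≠ 0 := by
    rintro rfl
    obtain ⟨k, hk, e⟩ := hy.start
    rw [hy.fin] at e
    exact hl3 (e ▸ hp.ins k hk)
  have hchord : ∀ {a b : ℕ}, a + 1 < b → b ≤ m → ¬ G.Adj (p a) (p b) := by
    intro a b h1 h2 h3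
    have := hp.chord hpm (by omega) h2 h3
    omega
  obtain ⟨k, hk, ek⟩ := hy.start
  have hyk := hy.adj 0 (by omega)
  rw [← ek, zero_add] at hyk
  have hD1 : D ≠ 1 := by
    rintro rfl
    rw [hy.fin] at hyk
    have k0 : k ≠ 0 := by rintro rfl; rw [p0] at hyk; exact a13 hyk
    have km : k ≠ m := by rintro rfl; rw [pm] at hyk; exact a23 hyk
    have b1 := hp.adj (k-1) (by omega)
    rw [show k - 1 + 1 = k by omega] at b1
    have b2 := hp.adj k (by omega)
    have un := u3 _ (hΓp k hk) hyk.symm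
    refine hcl (p k) (p (k-1)) (p (k+1)) l3 b1.symm b2 hyk (hp.inj hpm (by omega) (by omega)) ?_ ?_
      (hchord (by omega) (by omega)) ?_ ?_ (hLp _ (by omega)) (hLp _ (by omega))
    · intro e; exact hl3 (e ▸ hp.ins _ (by omega))
    · intro e; exact hl3 (e ▸ hp.ins _ (by omega))
    · intro e
      have := u3 _ (hΓp (k-1) (by omega)) e.symm
      exact b1.ne (this.trans un.symm)
    · intro e
      have := u3 _ (hΓp (k+1) (by omega)) e.symm
      exact b2.ne (un.trans this.symm)
  set w := y 1 with hw1
  have hwP : ∀ a, a ≤ m → p a ≠ w := fun a ha e => hy.notA hym (k := 1) le_rfl (by omega) ⟨a, ha, e⟩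
  have hw2P : ∀ a, a ≤ m → p a ≠ y 2 := fun a ha e => hy.notA hym (k := 2) (by omega) (by omega) ⟨a, ha, e⟩
  have hw2a : ∀ a, a ≤ m → ¬ G.Adj (p a) (y 2) := fun a ha =>
    hy.notAdj hym le_rfl (by omega) ⟨a, ha, rfl⟩ (hΓp a ha)
  have hww : G.Adj w (y 2) := hy.adj 1 (by omega)
  have hΓw : Γ w := hy.ins 1 (by omega)
  have nw0 : ¬ G.Adj (p 0) w := by
    intro e
    rw [p0] at e
    exact hwP 1 (by omega) (p1.trans (u1 _ hΓw e).symm)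
  have nwm : ¬ G.Adj (p m) w := by
    intro e
    rw [pm] at e
    exact hwP (m-1) (by omega) (pm1.trans (u2 _ hΓw e).symm)
  have two : ∀ {a b}, a < b → b ≤ m → G.Adj (p a) w → G.Adj (p b) w → b = a + 1 := by
    intro a b h1 h2 h3 h4
    by_contra hne
    exact hcl w (p a) (p b) (y 2) h3.symm h4.symm hww (hp.inj hpm h1 h2) (hw2P _ (by omega))
      (hw2P _ h2) (hchord (by omega) h2) (hw2a _ (by omega)) (hw2a _ h2) (hLp _ (by omega)) (hLp _ h2)
  have ex : ∃ k, k + 1 ≤ m ∧ G.Adj (p k) w ∧ G.Adj (p (k+1)) w := by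
    have k0 : k ≠ 0 := by rintro rfl; exact nw0 hyk
    have km : k ≠ m := by rintro rfl; exact nwm hyk
    by_contra hno
    push Not at hno
    have b1 := hp.adj (k-1) (by omega)
    rw [show k - 1 + 1 = k by omega] at b1
    have b2 := hp.adj k (by omega)
    refine hcl (p k) (p (k-1)) (p (k+1)) w b1.symm b2 hyk (hp.inj hpm (by omega) (by omega))
      (hwP _ (by omega)) (hwP _ (by omega))
      (hchord (by omega) (by omega)) ?_ ?_ (hLp _ (by omega)) (hLp _ (by omega))
    · intro e
      refine hno (k-1) (by omega) e ?_
      rwa [show k - 1 + 1 = k by omega]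
    · intro e
      exact hno k (by omega) hyk e
  obtain ⟨k, hk, e1, e2⟩ := ex
  have only : ∀ a, a ≤ m → a ≠ k → a ≠ k + 1 → ¬ G.Adj (p a) w := by
    intro a ha h1 h2 h3
    rcases lt_or_gt_of_ne h1 with h4 | h4
    · have := two (by omega) hk h3 e2; omega
    · have := two (by omega) ha e1 h3; omega
  have k0 : k ≠ 0 := by rintro rfl; exact nw0 e1
  have km : k + 1 ≠ m := by intro h; rw [h] at e2; exact nwm e2
  have kk := hp.adj k (by omega)
  have k2 : k < 2 := by
    by_contra hk2
    have b1 := hp.adj (k-1) (by omega)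
    rw [show k - 1 + 1 = k by omega] at b1
    have b2 := hp.adj (k-2) (by omega)
    rw [show k - 2 + 1 = k - 1 by omega] at b2
    have := (hw (p (k+1)) (p k) w (p (k+2)) (p (k-1)) (p (k-2)) kk.symm e1 e2
      (hp.adj (k+1) (by omega)) b1.symm b2.symm
      (fun e => hchord (by omega) (by omega) e.symm) (fun e => hchord (by omega) (by omega) e.symm)
      (hchord (by omega) (by omega)) (fun e => hchord (by omega) (by omega) e.symm)
      (fun e => only _ (by omega) (by omega) (by omega) e.symm)
      (fun e => only _ (by omega) (by omega) (by omega) e.symm)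
      (fun e => only _ (by omega) (by omega) (by omega) e.symm)
      (fun e => hchord (by omega) (by omega) e.symm) (fun e => hchord (by omega) (by omega) e.symm)).1
    exact this ⟨hLp _ (by omega), hLp _ (by omega)⟩
  obtain rfl : k = 1 := by omega
  have m3 : m = 3 := by
    by_contra hm3
    have := (hw (p 1) (p 2) w (p 0) (p 3) (p 4) kk e2 e1 (hp.adj 0 (by omega)).symm
      (hp.adj 2 (by omega)) (hp.adj 3 (by omega))
      (hchord (by omega) (by omega)) (hchord (by omega) (by omega))
      (fun e => hchord (by omega) (by omega) e.symm) (hchord (by omega) (by omega))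
      (fun e => only _ (by omega) (by omega) (by omega) e.symm)
      (fun e => only _ (by omega) (by omega) (by omega) e.symm)
      (fun e => only _ (by omega) (by omega) (by omega) e.symm)
      (hchord (by omega) (by omega)) (hchord (by omega) (by omega))).1
    exact this ⟨hLp _ (by omega), hLp _ (by omega)⟩
  subst m3
  have D2 : D = 2 := by
    by_contra hD2
    have h3a : ∀ a, a ≤ 3 → ¬ G.Adj (p a) (y 3) := fun a ha =>
      hy.notAdj hym (by omega) (by omega) ⟨a, ha, rfl⟩ (hΓp a ha)
    have := (hw (p 1) w (p 2) (p 0) (y 2) (y 3) e1 e2.symm kk (hp.adj 0 (by omega)).symm hww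
      (hy.adj 2 (by omega)) (hw2a _ (by omega)) (h3a _ (by omega)) (fun e => nw0 e.symm)
      (fun e => by have := hy.chord hym (a := 1) (b := 3) (by omega) (by omega) e; omega)
      (fun e => hchord (by omega) (by omega) e.symm) (hw2a _ (by omega)) (h3a _ (by omega))
      (hw2a _ (by omega)) (h3a _ (by omega))).2.2
    exact this ⟨hLp _ (by omega), hLp _ (by omega)⟩
  subst D2
  have hwn : w = n3 := u3 _ hΓw (by rw [← hy.fin]; exact hww.symm)
  have e2' : G.Adj n2 n3 := by rw [← pm1, ← hwn]; exact e2
  have e1' : G.Adj n1 n3 := by rw [← p1, ← hwn]; exact e1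
  have kk' : G.Adj n1 n2 := by rw [← p1, ← pm1]; exact kk
  exact ⟨kk', e1', e2'⟩

end NSection


section CtxSection

variable {V : Type} [DecidableEq V]

/-- the standing assumptions of the local argument -/
structure Ctx (G F : SimpleGraph V) (L : V → Prop) (u : ℤ → V) (N m : ℤ) (Z : Finset V)
    (z1 zr : V) : Prop where
  ear : Ear F u N m Z z1 zr
  hF : ∀ x y, F.Adj x y ↔ G.Adj x y ∨ (x ≠ y ∧ ¬ L x ∧ ¬ L y)
  cl : ClawLt G L
  wl : WLt G L
  gadj : ∀ t, G.Adj (u t) (u (t+1))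
  gz1 : G.Adj (u 0) z1
  gzr : G.Adj zr (u m)
  gZ : HP G Z z1 zr
  hmin : ∀ Z' a b s t, HP G Z' a b → (∀ t, u t ∉ Z') → G.Adj (u s) a → G.Adj b (u t) →
    u s ≠ u t → Z.card ≤ Z'.card

variable {G F : SimpleGraph V} {L : V → Prop} {u : ℤ → V} {N m : ℤ} {Z : Finset V} {z1 zr : V}

theorem Ctx.reflect (h : Ctx G F L u N m Z z1 zr) :
    Ctx G F L (fun t => u (-t)) N (N - m) Z z1 zr := by
  refine ⟨h.ear.reflect, h.hF, h.cl, h.wl, ?_, by simpa using h.gz1, ?_, h.gZ, ?_⟩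
  · intro t
    have := (h.gadj (-(t+1))).symm
    show G.Adj (u (-t)) (u (-(t+1)))
    convert this using 2
    ring
  · show G.Adj zr (u (-(N-m)))
    rw [← h.ear.cy.per (-(N-m))]
    convert h.gzr using 2
    ring
  · intro Z' a b s t h1 h2 h3 h4 h5
    exact h.hmin Z' a b (-s) (-t) h1 (fun r => by simpa using h2 (-r)) h3 h4 h5

theorem Ctx.shift (h : Ctx G F L u N m Z z1 zr) :
    Ctx G F L (fun t => u (t + m)) N (N - m) Z zr z1 := by
  refine ⟨h.ear.shift, h.hF, h.cl, h.wl, ?_, by simpa using h.gzr.symm, ?_, h.gZ.rev, ?_⟩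
  · intro t
    have := h.gadj (t+m)
    show G.Adj (u (t+m)) (u (t+1+m))
    convert this using 2
    ring
  · show G.Adj z1 (u (N - m + m))
    have := h.ear.cy.per 0
    rw [sub_add_cancel, ← zero_add N, this]
    exact h.gz1.symm
  · intro Z' a b s t h1 h2 h3 h4 h5
    exact h.hmin Z' a b (s+m) (t+m) h1 (fun r => by simpa using h2 (r-m)) h3 h4 h5

theorem Ctx.le (h : Ctx G F L u N m Z z1 zr) {x y : V} (e : G.Adj x y) : F.Adj x y :=
  (h.hF x y).2 (Or.inl e)

theorem Ctx.ng (h : Ctx G F L u N m Z z1 zr) {x y : V} (e : ¬ F.Adj x y) : ¬ G.Adj x y :=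
  fun e' => e (h.le e')

theorem Ctx.ng' (h : Ctx G F L u N m Z z1 zr) {x y : V} (e : ¬ F.Adj x y) : ¬ G.Adj y x :=
  fun e' => e (h.le e'.symm)

theorem Ctx.clawF (h : Ctx G F L u N m Z z1 zr) {c x y w : V} (h1 : G.Adj c x) (h2 : G.Adj c y)
    (h3 : G.Adj c w) (h4 : x ≠ y) (h5 : x ≠ w) (h6 : y ≠ w) (h7 : ¬ F.Adj x w) (h8 : ¬ F.Adj y w) :
    F.Adj x y := by
  by_contra hn
  have n1 := h.ng hn
  have n2 := h.ng h7
  have n3 := h.ng h8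
  have a1 := h.cl c x y w h1 h2 h3 h4 h5 h6 n1 n2 n3
  have a2 := h.cl c x w y h1 h3 h2 h5 h4 h6.symm n2 n1 (fun e => n3 e.symm)
  have a3 := h.cl c y w x h2 h3 h1 h6 h4.symm h5.symm n3 (fun e => n1 e.symm) (fun e => n2 e.symm)
  have b1 := mt (h.hF x y).2 hn
  have b2 := mt (h.hF x w).2 h7
  have b3 := mt (h.hF y w).2 h8
  tauto

theorem Ctx.offz (h : Ctx G F L u N m Z z1 zr) : Off F u z1 :=
  ⟨{z1}, z1, HP.single z1, fun t => by simpa using h.ear.z_ne t, h.ear.adj1⟩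

theorem Ctx.offy (h : Ctx G F L u N m Z z1 zr) {y : V} (hy : F.Adj z1 y) (hyC : ∀ t, u t ≠ y) :
    Off F u y :=
  ⟨{z1, y}, z1, HP.pair hy, fun t => by simpa using ⟨h.ear.z_ne t, hyC t⟩, h.ear.adj1⟩

theorem Ctx.F3 (h : Ctx G F L u N m Z z1 zr) : F.Adj (u 1) (u (-1)) := by
  have hb := h.ear.sep Comp.base Comp.base
  have h3 := h.ear.cy.three
  have e1 := h.gadj 0
  have e2 := (h.gadj (-1)).symm
  simp only [zero_add] at e1
  simp only [neg_add_cancel] at e2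
  refine h.clawF e1 e2 h.gz1 ?_ (h.ear.z_ne _) (h.ear.z_ne _) ?_ ?_
  · intro e
    have := h.ear.cy.inj' (by omega) (by omega) e
    omega
  · intro e
    exact h.ear.N1' Comp.base h.offz (t := 1) (by omega) (by omega) (by omega) e.symm
  · intro e
    exact h.ear.N1' Comp.base h.offz (t := -1) (by omega) (by omega) (by omega) e.symm

theorem Ctx.comp11 (h : Ctx G F L u N m Z z1 zr) : Comp F u 1 1 := by
  have := Comp.both (F := F) (u := u) Comp.base (by simpa using h.F3)
  simpa using this

theorem Ctx.F3v (h : Ctx G F L u N m Z z1 zr) : F.Adj (u (m-1)) (u (m+1)) := by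
  have := h.shift.F3.symm
  convert this using 2 <;> ring

/-- a maximal stage -/
structure Mx (F : SimpleGraph V) (u : ℤ → V) (i j : ℤ) : Prop where
  comp : Comp F u i j
  hi : 1 ≤ i
  hj : 1 ≤ j
  n1 : ∀ t, -j ≤ t → t < i → ¬ F.Adj (u (i+1)) (u t)
  n2 : ∀ t, -j < t → t ≤ i → ¬ F.Adj (u (-j-1)) (u t)
  n3 : ¬ F.Adj (u (i+1)) (u (-j-1))

theorem Mx.reflect {i j : ℤ} (h : Mx F u i j) : Mx F (fun t => u (-t)) j i := by
  refine ⟨h.comp.reflect, h.hj, h.hi, ?_, ?_, ?_⟩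
  · intro t h1 h2
    have := h.n2 (-t) (by omega) (by omega)
    convert this using 3; ring
  · intro t h1 h2
    have := h.n1 (-t) (by omega) (by omega)
    convert this using 3; ring
  · intro e
    apply h.n3
    have := e.symm
    convert this using 2 <;> ring

theorem Ctx.exists_mx (h : Ctx G F L u N m Z z1 zr) : ∃ i j, Mx F u i j := by
  obtain ⟨i, j, h1, h2, h3, h4⟩ := h.ear.exists_max h.comp11
  refine ⟨i, j, h1, h2, h3, ?_, ?_, ?_⟩
  · intro t a b e
    have := h4 _ _ (by omega) (by omega) (Comp.right h1 a b e)
    omega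
  · intro t a b e
    have := h4 _ _ (by omega) (by omega) (Comp.left h1 a b e)
    omega
  · intro e
    have := h4 _ _ (by omega) (by omega) (Comp.both h1 e)
    omega

theorem Ctx.bounds (h : Ctx G F L u N m Z z1 zr) {i j : ℤ} (hm : Mx F u i j) :
    i + 2 < m ∧ j + 2 < N - m := by
  have := h.ear.sep hm.comp h.shift.comp11
  omega

/-- the three conclusions of the net argument -/
def Tri (G : SimpleGraph V) (u : ℤ → V) (i j : ℤ) : Prop :=
  G.Adj (u 0) (u i) ∧ G.Adj (u 0) (u (-j)) ∧ G.Adj (u i) (u (-j))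

theorem Ctx.unq (h : Ctx G F L u N m Z z1 zr) {i j : ℤ} (hm : Mx F u i j) {x : V}
    (hx : x = z1 ∨ ∃ t, -(j+1) ≤ t ∧ t ≤ i+1 ∧ u t = x) :
    (G.Adj (u (i+1)) x → x = u i) ∧ (G.Adj (u (-j-1)) x → x = u (-j)) ∧ (G.Adj z1 x → x = u 0) := by
  have hi := hm.hi
  have hj := hm.hj
  have key : ∀ t, -(j+1) ≤ t → t ≤ i + 1 → t ≠ 0 → ¬ G.Adj z1 (u t) := by
    intro t h1 h2 h3
    exact h.ng (h.ear.N1' hm.comp h.offz h3 h1 h2)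
  rcases hx with rfl | ⟨t, h1, h2, rfl⟩
  · refine ⟨fun e => absurd e.symm (key _ (by omega) (by omega) (by omega)),
      fun e => absurd e.symm (key _ (by omega) (by omega) (by omega)), fun e => absurd rfl e.ne⟩
  · refine ⟨fun e => ?_, fun e => ?_, fun e => ?_⟩
    · by_cases c1 : t = i
      · rw [c1]
      by_cases c2 : t = i + 1
      · subst c2; exact absurd rfl e.ne
      by_cases c3 : t = -j-1
      · subst c3; exact absurd (h.le e) hm.n3
      · exact absurd (h.le e) (hm.n1 t (by omega) (by omega))
    · by_cases c1 : t = -j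
      · rw [c1]
      by_cases c2 : t = -j - 1
      · subst c2; exact absurd rfl e.ne
      by_cases c3 : t = i+1
      · subst c3; exact absurd (h.le e.symm) hm.n3
      · exact absurd (h.le e) (hm.n2 t (by omega) (by omega))
    · by_cases c1 : t = 0
      · rw [c1]
      · exact absurd e (key t h1 h2 c1)

theorem Ctx.tri1 (h : Ctx G F L u N m Z z1 zr) {i j : ℤ} (hm : Mx F u i j)
    (hl : ∀ t, t ≠ 0 → -(j+1) ≤ t → t ≤ i + 1 → L (u t)) : Tri G u i j := by
  have hb := h.bounds hm
  have hi := hm.hi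
  have hj := hm.hj
  have h3 := h.ear.cy.three
  have e11 : G.Adj (u (-1)) (u 1) := by
    rcases (h.hF _ _).1 h.F3 with e | ⟨-, e, -⟩
    · exact e.symm
    · exact absurd (hl 1 (by omega) (by omega) (by omega)) e
  have gz : ∀ t, -(j+1) ≤ t → t ≤ i + 1 → t ≠ 0 → ¬ G.Adj z1 (u t) := fun t h1 h2 h3 =>
    h.ng (h.ear.N1' hm.comp h.offz h3 h1 h2)
  have := net_lemma (G := G) (L := L) (Γ := fun x => x = z1 ∨ ∃ t, -(j+1) ≤ t ∧ t ≤ i+1 ∧ u t = x)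
    (Λ := fun x => ∃ t, t ≠ 0 ∧ -(j+1) ≤ t ∧ t ≤ i+1 ∧ u t = x) h.cl h.wl
    (l1 := u (-j-1)) (l2 := u (i+1)) (l3 := z1) (n1 := u (-j)) (n2 := u i) (n3 := u 0)
    (fun v ⟨t, h1, h2, h3, h4⟩ => Or.inr ⟨t, h2, h3, h4⟩)
    (fun v ⟨t, h1, h2, h3, h4⟩ => h4 ▸ hl t h1 h2 h3)
    (fun e => by have := h.ear.cy.inj' (by omega) (by omega) e; omega)
    (fun ⟨t, h1, h2, h3, h4⟩ => h.ear.z_ne t h4)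
    (fun x hx => (h.unq hm hx).2.1) (fun x hx => (h.unq hm hx).1) (fun x hx => (h.unq hm hx).2.2)
    (h.ng' hm.n3) (fun e => gz _ (by omega) (by omega) (by omega) e.symm)
    (fun e => gz _ (by omega) (by omega) (by omega) e.symm)
    ⟨(i+j+1).toNat, fun k => if (k:ℤ) ≤ j then u (k - (j+1)) else u (k - j), by
      simp only [Nat.cast_zero]
      rw [if_pos (by omega)]; congr 1; ring, by
      try simp only
      rw [if_neg (by omega)]; congr 1; omega, by
      intro k hk
      try dsimp only
      split_ifs with c
      · exact ⟨_, by omega, by omega, by omega, rfl⟩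
      · exact ⟨_, by omega, by omega, by omega, rfl⟩, by
      intro k hk
      try dsimp only
      push_cast
      rcases lt_trichotomy (k:ℤ) j with c | c | c
      · rw [if_pos (by omega), if_pos (by omega)]
        convert h.gadj _ using 2; ring
      · rw [if_pos (by omega), if_neg (by omega)]
        convert e11 using 2 <;> omega
      · rw [if_neg (by omega), if_neg (by omega)]
        convert h.gadj _ using 2; ring⟩
    ⟨(j+2).toNat, fun k => if (k:ℤ) ≤ j + 1 then u (k - (j+1)) else z1, by
      simp only [Nat.cast_zero]
      rw [if_pos (by omega)]; congr 1; ring, by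
      try simp only
      rw [if_neg (by omega)], by
      intro k hk
      try dsimp only
      split_ifs with c
      · exact Or.inr ⟨_, by omega, by omega, rfl⟩
      · exact Or.inl rfl, by
      intro k hk
      try dsimp only
      push_cast
      rcases lt_or_ge (k:ℤ) (j+1) with c | c
      · rw [if_pos (by omega), if_pos (by omega)]
        convert h.gadj _ using 2; ring
      · rw [if_pos (by omega), if_neg (by omega)]
        convert h.gz1 using 2; omega⟩
  exact ⟨this.2.2.symm, this.2.1.symm, this.1.symm⟩

theorem Ctx.tri2 (h : Ctx G F L u N m Z z1 zr) {i j : ℤ} (hm : Mx F u i j)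
    (hl : ∀ t, -(j+1) ≤ t → t ≤ 0 → L (u t)) (hz : L z1) : Tri G u i j := by
  have hb := h.bounds hm
  have hi := hm.hi
  have hj := hm.hj
  have h3 := h.ear.cy.three
  have gz : ∀ t, -(j+1) ≤ t → t ≤ i + 1 → t ≠ 0 → ¬ G.Adj z1 (u t) := fun t h1 h2 h3 =>
    h.ng (h.ear.N1' hm.comp h.offz h3 h1 h2)
  have := net_lemma (G := G) (L := L) (Γ := fun x => x = z1 ∨ ∃ t, -(j+1) ≤ t ∧ t ≤ i+1 ∧ u t = x)
    (Λ := fun x => x = z1 ∨ ∃ t, -(j+1) ≤ t ∧ t ≤ 0 ∧ u t = x) h.cl h.wl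
    (l1 := z1) (l2 := u (-j-1)) (l3 := u (i+1)) (n1 := u 0) (n2 := u (-j)) (n3 := u i)
    (fun v hv => hv.imp id (fun ⟨t, h2, h3, h4⟩ => ⟨t, h2, by omega, h4⟩))
    (fun v hv => by
      rcases hv with rfl | ⟨t, h1, h2, rfl⟩
      · exact hz
      · exact hl t h1 h2)
    (h.ear.z_ne _).symm
    (by
      rintro (e | ⟨t, h1, h2, e⟩)
      · exact h.ear.z_ne _ e
      · have := h.ear.cy.inj' (by omega) (by omega) e; omega)
    (fun x hx => (h.unq hm hx).2.2) (fun x hx => (h.unq hm hx).2.1) (fun x hx => (h.unq hm hx).1)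
    (gz _ (by omega) (by omega) (by omega)) (gz _ (by omega) (by omega) (by omega))
    (h.ng' hm.n3)
    ⟨(j+2).toNat, fun k => if k = 0 then z1 else u (1 - k), by simp, by
      try simp only
      rw [if_neg (by omega)]; congr 1; omega, by
      intro k hk
      try dsimp only
      split_ifs with c
      · exact Or.inl rfl
      · exact Or.inr ⟨_, by omega, by omega, rfl⟩, by
      intro k hk
      try dsimp only
      push_cast
      split_ifs with c
      · subst c
        simpa using h.gz1.symm
      · convert (h.gadj (1 - (k+1))).symm using 2
        ring⟩
    ⟨(i+2).toNat, fun k => if k = 0 then z1 else u (k - 1), by simp, by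
      try simp only
      rw [if_neg (by omega)]; congr 1; omega, by
      intro k hk
      try dsimp only
      split_ifs with c
      · exact Or.inl rfl
      · exact Or.inr ⟨_, by omega, by omega, rfl⟩, by
      intro k hk
      try dsimp only
      push_cast
      split_ifs with c
      · subst c
        simpa using h.gz1.symm
      · convert (h.gadj (k - 1)) using 2
        ring⟩
  exact ⟨this.2.1, this.1, this.2.2.symm⟩

end CtxSection


section EndSection

variable {V : Type} [DecidableEq V]
variable {G F : SimpleGraph V} {L : V → Prop} {u : ℤ → V} {N m : ℤ} {Z : Finset V} {z1 zr : V}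

/-- the two types of light end -/
def LightEnd (L : V → Prop) (u : ℤ → V) (z1 : V) (i j : ℤ) : Prop :=
  (∀ t, t ≠ 0 → -(j+1) ≤ t → t ≤ i + 1 → L (u t)) ∨
    ((∀ t, -(j+1) ≤ t → t ≤ 0 → L (u t)) ∧ L z1)

theorem Ctx.tri (h : Ctx G F L u N m Z z1 zr) {i j : ℤ} (hm : Mx F u i j)
    (hl : LightEnd L u z1 i j) : Tri G u i j := by
  rcases hl with hl | ⟨hl, hz⟩
  · exact h.tri1 hm hl
  · exact h.tri2 hm hl hz

theorem Ctx.W1 (h : Ctx G F L u N m Z z1 zr) {i j : ℤ} (hm : Mx F u i j)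
    (hl : LightEnd L u z1 i j) {g : V} (hg : G.Adj z1 g)
    (hgt : ∀ t, t ≠ 0 → -(j+1) ≤ t → t ≤ i + 1 → ¬ F.Adj g (u t)) : G.Adj (u 0) g := by
  by_contra hn
  obtain ⟨t1, t2, t3⟩ := h.tri hm hl
  have hi := hm.hi
  have hj := hm.hj
  have gz : ∀ t, -(j+1) ≤ t → t ≤ i + 1 → t ≠ 0 → ¬ F.Adj z1 (u t) := fun t h1 h2 h3 =>
    (h.ear.N1' hm.comp h.offz h3 h1 h2)
  have e1 := h.gadj (-j-1)
  rw [show -j-1+1 = -j by ring] at e1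
  have := h.wl (u (-j)) (u 0) (u i) (u (-j-1)) z1 g t2.symm t1 t3.symm e1.symm h.gz1 hg
    (h.ng' (gz _ (by omega) (by omega) (by omega))) (h.ng' (hgt _ (by omega) (by omega) (by omega)))
    (h.ng' (hm.n2 0 (by omega) (by omega))) hn (h.ng' (hm.n2 i (by omega) (by omega)))
    (h.ng' (gz _ (by omega) (by omega) (by omega))) (h.ng' (hgt _ (by omega) (by omega) (by omega)))
    (h.ng' (gz _ (by omega) (by omega) (by omega))) (h.ng' (hgt _ (by omega) (by omega) (by omega)))
  rcases hl with hl | ⟨hl, hz⟩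
  · exact this.2.2 ⟨hl _ (by omega) (by omega) (by omega), hl _ (by omega) (by omega) (by omega)⟩
  · exact this.1 ⟨hl _ (by omega) (by omega), hz⟩

theorem Ctx.W1off (h : Ctx G F L u N m Z z1 zr) {i j : ℤ} (hm : Mx F u i j)
    (hl : LightEnd L u z1 i j) {g : V} (hg : G.Adj z1 g) (hgC : ∀ t, u t ≠ g) : G.Adj (u 0) g :=
  h.W1 hm hl hg (fun _ h0 h1 h2 => h.ear.N1' hm.comp (h.offy (h.le hg) hgC) h0 h1 h2)

theorem Ctx.u0_ne (h : Ctx G F L u N m Z z1 zr) : u 0 ≠ u m := by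
  have h1 := h.ear.mpos
  have h2 := h.ear.mlt
  intro e
  have := h.ear.cy.inj' (by omega) (by omega) e
  omega

theorem Ctx.single (h : Ctx G F L u N m Z z1 zr) {i j : ℤ} (hm : Mx F u i j)
    (hl : LightEnd L u z1 i j) : zr = z1 := by
  have hd := h.ear.disj
  have hmin := h.hmin
  have hzr := h.gzr
  have hne := h.u0_ne
  cases h.gZ with
  | single => rfl
  | @cons X _ y _ hxy hX hp =>
    exfalso
    have hg : G.Adj (u 0) y := h.W1off hm hl hxy (fun t e => hd t (by
      rw [e]; exact Finset.mem_insert_of_mem hp.left_mem))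
    have := hmin X y zr 0 m hp (fun t e => hd t (Finset.mem_insert_of_mem e)) hg hzr hne
    rw [Finset.card_insert_of_notMem hX] at this
    omega

theorem Ctx.z_heavy (h : Ctx G F L u N m Z z1 zr) {i j : ℤ} (hm : Mx F u i j)
    (hl : LightEnd L u z1 i j) : ¬ L z1 := by
  intro hz
  have e := h.single hm hl
  subst e
  have hi := hm.hi
  have hj := hm.hj
  have hv := h.F3v
  have n2 : ∀ t, t ≠ 0 → -(j+1) ≤ t → t ≤ i + 1 → ¬ F.Adj (u m) (u t) := fun t h0 h1 h2 e =>
    h.ear.N2' hm.comp hv h0 h1 h2 e.symm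
  have huv : G.Adj (u 0) (u m) := h.W1 hm hl h.gzr n2
  obtain ⟨t1, t2, t3⟩ := h.tri hm hl
  have gz : ∀ t, -(j+1) ≤ t → t ≤ i + 1 → t ≠ 0 → ¬ F.Adj zr (u t) := fun t h1 h2 h3 =>
    (h.ear.N1' hm.comp h.offz h3 h1 h2)
  have e1 := h.gadj (-j-1)
  rw [show -j-1+1 = -j by ring] at e1
  have e2 := h.gadj (m-1)
  rw [sub_add_cancel] at e2
  have f1 : ¬ F.Adj (u 0) (u (m-1)) := by
    have := h.shift.ear.N2' Comp.base h.shift.F3v (t := -1) (by omega) (by omega) (by omega)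
    intro e
    apply this
    have hp := h.ear.cy.per 0
    rw [zero_add] at hp
    show F.Adj (u (-1 + m)) (u (N - m + m))
    rw [sub_add_cancel, hp, show -1 + m = m - 1 by ring]
    exact e.symm
  have f2 : ¬ F.Adj zr (u (m-1)) := by
    have := h.shift.ear.N1' Comp.base h.shift.offz (t := -1) (by omega) (by omega) (by omega)
    rwa [show -1 + m = m - 1 by ring] at this
  have f3 : ∀ t, 1 ≤ t → t ≤ j + 1 → ¬ F.Adj (u (-t)) (u (m-1)) := fun t h1 h2 =>
    h.ear.N3' hm.comp Comp.base h1 h2 (by omega) (by omega)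
  have f4 := f3 (j+1) (by omega) (by omega)
  rw [show -(j+1) = -j-1 by ring] at f4
  have := h.wl (u m) (u 0) zr (u (m-1)) (u (-j)) (u (-j-1)) huv.symm h.gz1 h.gzr.symm e2.symm t2
    e1.symm (h.ng (n2 _ (by omega) (by omega) (by omega))) (h.ng (n2 _ (by omega) (by omega) (by omega)))
    (h.ng f1) (h.ng' (hm.n2 0 (by omega) (by omega))) (h.ng f2)
    (h.ng (gz _ (by omega) (by omega) (by omega))) (h.ng (gz _ (by omega) (by omega) (by omega)))
    (h.ng' (f3 j (by omega) (by omega))) (h.ng' f4)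
  refine this.2.1 ⟨?_, hz⟩
  rcases hl with hl | ⟨hl, -⟩
  · exact hl _ (by omega) (by omega) (by omega)
  · exact hl _ (by omega) (by omega)

theorem Cy.count [Fintype V] [DecidableRel G.Adj] (h : Cy F u N) (hle : G ≤ F) {z : V}
    (hz : ∀ t, u t ≠ z) (hz0 : G.Adj (u 0) z) (Y : Finset V) (hYC : ∀ t, u t ∉ Y)
    (hY : ∀ y ∈ Y, G.Adj z y) (hYall : ∀ y, G.Adj z y → (∀ t, u t ≠ y) → y ∈ Y)
    (hY0 : ∀ y ∈ Y, G.Adj (u 0) y) (hcl : ∀ y ∈ Y, ∀ y' ∈ Y, y ≠ y' → F.Adj y y') :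
    2 * G.degree z + 1 ≤ Fintype.card V := by
  have h3 := h.three
  have hzY : z ∉ Y := fun e => (hY z e).ne rfl
  obtain ⟨y, hy, hp⟩ := HP.of_clique (F := F) Y z hzY (by
    intro a ha b hb hab
    rw [Finset.mem_insert] at ha hb
    rcases ha with rfl | ha <;> rcases hb with rfl | hb
    · exact absurd rfl hab
    · exact hle (hY _ hb)
    · exact hle (hY _ ha).symm
    · exact hcl _ ha _ hb hab)
  have huN : u N = u 0 := by have := h.per 0; rwa [zero_add] at this
  have hy0 : G.Adj (u 0) y := by
    rw [Finset.mem_insert] at hy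
    rcases hy with rfl | hy
    · exact hz0
    · exact hY0 _ hy
  have hsegcard : ∀ a b, a ≤ b + 1 → b < a + N → ((seg u a b).card : ℤ) = b - a + 1 := by
    intro a b hab hb
    rw [seg, Finset.card_image_of_injOn]
    · simp; omega
    · intro s hs t ht e
      simp at hs ht
      exact h.inj' (by omega) (by omega) e
  have hdisj : ∀ a b, Disjoint (insert z Y) (seg u a b) := by
    intro a b
    rw [Finset.disjoint_right]
    intro x hx
    obtain ⟨t, -, -, rfl⟩ := mem_seg.1 hx
    rw [Finset.mem_insert]
    rintro (e | e)
    · exact hz t e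
    · exact hYC t e
  have low : ∀ t, 1 ≤ t → t ≤ N → G.Adj z (u t) → (Y.card : ℤ) + 2 ≤ t := by
    intro t h1 h2 h4
    have hc := hp.join (h.hp_seg h2 (by omega)) (hle h4) (hdisj _ _)
    have := h.hmax _ _ _ hc (by rw [huN]; exact hle hy0)
    rw [Finset.card_union_of_disjoint (hdisj _ _), Finset.card_insert_of_notMem hzY] at this
    push_cast at this
    rw [hsegcard t N (by omega) (by omega)] at this
    omega
  have succ : ∀ t, G.Adj z (u t) → ¬ G.Adj z (u (t+1)) := by
    intro t h1 h2
    have hd : Disjoint {z} (seg u (t+1) (t+N)) :=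
      Finset.disjoint_of_subset_left (by simp) (hdisj _ _)
    have hc := (HP.single (F := F) z).join (h.hp_seg (a := t+1) (b := t+N) (by omega) (by omega)) (hle h2)
      hd
    have := h.hmax _ _ _ hc (by rw [h.per]; exact hle h1.symm)
    rw [Finset.card_union_of_disjoint hd] at this
    push_cast at this
    rw [hsegcard _ _ (by omega) (by omega)] at this
    simp at this
  set I := (Finset.Icc 1 N).filter (fun t => G.Adj z (u t)) with hI
  set J := (Finset.Icc 1 N).filter (fun t => ¬ G.Adj z (u t)) with hJ
  have hNI : N ∈ I := by
    rw [hI, Finset.mem_filter, Finset.mem_Icc]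
    exact ⟨⟨by omega, le_rfl⟩, by rw [huN]; exact hz0.symm⟩
  have hIJ : I.card + J.card = N.toNat := by
    have := Finset.card_filter_add_card_filter_not (s := Finset.Icc (1:ℤ) N) (fun t => G.Adj z (u t))
    rw [Int.card_Icc] at this
    rw [hI, hJ, this]; congr 1; ring
  have hYN := low N (by omega) le_rfl (by rw [huN]; exact hz0.symm)
  have hsub : Finset.Icc (1:ℤ) (Y.card + 1) ∪ (I.erase N).image (fun t => t + 1) ⊆ J := by
    intro t ht
    rw [Finset.mem_union, Finset.mem_Icc, Finset.mem_image] at ht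
    rw [hJ, Finset.mem_filter, Finset.mem_Icc]
    rcases ht with ht | ⟨s, hs, rfl⟩
    · refine ⟨by omega, fun e => ?_⟩
      have := low t (by omega) (by omega) e
      omega
    · rw [Finset.mem_erase, hI, Finset.mem_filter, Finset.mem_Icc] at hs
      exact ⟨by omega, succ s hs.2.2⟩
  have hdis : Disjoint (Finset.Icc (1:ℤ) (Y.card + 1)) ((I.erase N).image (fun t => t + 1)) := by
    rw [Finset.disjoint_right]
    intro x hx hx'
    rw [Finset.mem_image] at hx
    obtain ⟨s, hs, rfl⟩ := hx
    rw [Finset.mem_erase, hI, Finset.mem_filter, Finset.mem_Icc] at hs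
    rw [Finset.mem_Icc] at hx'
    have := low s (by omega) (by omega) hs.2.2
    omega
  have hJc := Finset.card_le_card hsub
  rw [Finset.card_union_of_disjoint hdis, Int.card_Icc,
    Finset.card_image_of_injective _ (add_left_injective 1), Finset.card_erase_of_mem hNI] at hJc
  have hIpos : 0 < I.card := Finset.card_pos.2 ⟨N, hNI⟩
  have hdeg : G.degree z ≤ I.card + Y.card := by
    rw [← SimpleGraph.card_neighborFinset_eq_degree]
    refine le_trans (Finset.card_le_card (t := I.image u ∪ Y) ?_) ((Finset.card_union_le _ _).trans
      (Nat.add_le_add_right Finset.card_image_le _))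
    intro x hx
    rw [SimpleGraph.mem_neighborFinset] at hx
    rw [Finset.mem_union]
    by_cases hxC : ∀ t, u t ≠ x
    · exact Or.inr (hYall x hx hxC)
    · push Not at hxC
      obtain ⟨t, rfl⟩ := hxC
      obtain ⟨s, h1, h2, e⟩ := h.window t 1
      left
      rw [Finset.mem_image]
      refine ⟨s, ?_, e⟩
      rw [hI, Finset.mem_filter, Finset.mem_Icc, e]
      exact ⟨⟨h1, by omega⟩, hx⟩
  have htot := Finset.card_le_univ (insert z Y ∪ seg u 1 N)
  rw [Finset.card_union_of_disjoint (hdisj _ _), Finset.card_insert_of_notMem hzY] at htot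
  have := hsegcard 1 N (by omega) (by omega)
  omega

theorem Ctx.endgame [Fintype V] [DecidableRel G.Adj]
    (h : Ctx G F (fun v => ¬ Fintype.card V ≤ 2 * G.degree v) u N m Z z1 zr) {i j : ℤ}
    (hm : Mx F u i j)
    (hl : LightEnd (fun v => ¬ Fintype.card V ≤ 2 * G.degree v) u z1 i j) : False := by
  classical
  have hz := h.z_heavy hm hl
  push Not at hz
  have hle : G ≤ F := fun x y e => h.le e
  have e1 := h.gadj 0
  rw [zero_add] at e1
  have key : ∀ y, G.Adj z1 y → (∀ t, u t ≠ y) → ¬ F.Adj y (u 1) := fun y hy hyC =>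
    h.ear.N1' hm.comp (h.offy (h.le hy) hyC) (by omega) (by have := hm.hj; omega)
      (by have := hm.hi; omega)
  have := h.ear.cy.count hle h.ear.z_ne h.gz1
    (Finset.univ.filter (fun y => G.Adj z1 y ∧ ∀ t, u t ≠ y))
    (by intro t ht; simp at ht; exact ht.2 t rfl) (by intro y hy; simp at hy; exact hy.1)
    (by intro y h1 h2; simp; exact ⟨h1, h2⟩)
    (by intro y hy; simp at hy; exact h.W1off hm hl hy.1 hy.2)
    (by
      intro y hy y' hy' hne
      simp at hy hy'
      exact h.clawF (h.W1off hm hl hy.1 hy.2) (h.W1off hm hl hy'.1 hy'.2) e1 hne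
        (Ne.symm (hy.2 1)) (Ne.symm (hy'.2 1)) (key _ hy.1 hy.2) (key _ hy'.1 hy'.2))
  omega

theorem Ctx.final_aux [Fintype V] [DecidableRel G.Adj]
    (h : Ctx G F (fun v => ¬ Fintype.card V ≤ 2 * G.degree v) u N m Z z1 zr) {i j i' j' : ℤ}
    (hm : Mx F u i j) (hm' : Mx F (fun t => u (t + m)) i' j') {s r : ℤ} (h1 : 1 ≤ s) (h2 : s ≤ i + 1)
    (hs : Fintype.card V ≤ 2 * G.degree (u s)) (h3 : r ≠ 0) (h4 : -(j'+1) ≤ r) (h5 : r ≤ i' + 1)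
    (hr : Fintype.card V ≤ 2 * G.degree (u (m + r))) : False := by
  have hsep := h.ear.sep hm.comp hm'.comp
  have mpos := h.ear.mpos
  have mlt := h.ear.mlt
  have := hm.hi
  have := hm.hj
  have := hm'.hi
  have := hm'.hj
  have heavyAdj : ∀ x y, x ≠ y → Fintype.card V ≤ 2 * G.degree x → Fintype.card V ≤ 2 * G.degree y →
      F.Adj x y := fun x y e a b => (h.hF x y).2 (Or.inr ⟨e, not_not.2 a, not_not.2 b⟩)
  have hr0 : r < 0 := by
    by_contra hc
    refine h.ear.N3 hm.comp hm'.comp h1 h2 (s := r) (by omega) h5 (heavyAdj _ _ ?_ hs hr)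
    intro e
    have := h.ear.cy.inj' (by omega) (by omega) e
    omega
  refine h.endgame hm (Or.inr ⟨?_, ?_⟩)
  · intro t ht1 ht2 ht
    by_cases ht0 : t = 0
    · subst ht0
      have h0 := h.shift.ear.N2' hm'.comp h.shift.F3v (t := r) h3 h4 h5
      have hp := h.ear.cy.per 0
      rw [zero_add] at hp
      apply h0
      show F.Adj (u (r + m)) (u (N - m + m))
      rw [sub_add_cancel, hp, show r + m = m + r by ring]
      refine heavyAdj _ _ ?_ hr ht
      intro e
      have := h.ear.cy.inj' (by omega) (by omega) e
      omega
    · have := h.ear.N3' hm.comp hm'.comp (t := -t) (s := -r) (by omega) (by omega) (by omega) (by omega)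
      rw [neg_neg, sub_neg_eq_add] at this
      refine this (heavyAdj _ _ ?_ ht hr)
      intro e
      by_cases hc : m + r < t + N
      · have := h.ear.cy.inj' (by omega) (by omega) e
        omega
      · omega
  · intro hz
    exact h.ear.N1' hm.comp h.offz (t := s) (by omega) (by omega) h2
      (heavyAdj _ _ (h.ear.z_ne s).symm hz hs)

theorem Ctx.final [Fintype V] [DecidableRel G.Adj]
    (h : Ctx G F (fun v => ¬ Fintype.card V ≤ 2 * G.degree v) u N m Z z1 zr) : False := by
  obtain ⟨i, j, hm⟩ := h.exists_mx
  obtain ⟨i', j', hm'⟩ := h.shift.exists_mx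
  by_cases c1 : ∀ t, t ≠ 0 → -(j+1) ≤ t → t ≤ i + 1 → ¬ Fintype.card V ≤ 2 * G.degree (u t)
  · exact h.endgame hm (Or.inl c1)
  by_cases c2 : ∀ t, t ≠ 0 → -(j'+1) ≤ t → t ≤ i' + 1 →
      ¬ Fintype.card V ≤ 2 * G.degree (u (t + m))
  · exact h.shift.endgame hm' (Or.inl c2)
  push Not at c1 c2
  obtain ⟨s, s0, s1, s2, s3⟩ := c1
  obtain ⟨r, r0, r1, r2, r3⟩ := c2
  rw [add_comm] at r3
  rcases lt_or_gt_of_ne s0 with hs | hs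
  · refine h.reflect.final_aux hm.reflect (i' := j') (j' := i') ?_ (s := -s) (r := -r) (by omega)
      (by omega) ?_ (by omega) (by omega) (by omega) ?_
    · rw [h.ear.reflect_shift]
      exact hm'.reflect
    · show _ ≤ 2 * G.degree (u (- -s))
      rwa [neg_neg]
    · show _ ≤ 2 * G.degree (u (-(N - m + -r)))
      rw [← h.ear.cy.per]
      rwa [show -(N - m + -r) + N = m + r by ring]
  · exact h.final_aux hm hm' (by omega) s2 s3 r0 r1 r2 r3

end EndSection


section ClosureSection

variable {V : Type} [DecidableEq V]

theorem HP.self {F : SimpleGraph V} {X : Finset V} {x y : V} (h : HP F X x y) (e : x = y) : X = {x} := by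
  cases h with
  | single => rfl
  | cons h1 h2 h3 => subst e; exact absurd h3.right_mem h2

theorem HP.split {E E1 : SimpleGraph V} {a b : V}
    (hE : ∀ x y, E.Adj x y → E1.Adj x y ∨ s(x, y) = s(a, b)) {X : Finset V} {x y : V}
    (h : HP E X x y) : HP E1 X x y ∨ ∃ A B p q, HP E1 A x p ∧ HP E1 B q y ∧ Disjoint A B ∧
      A ∪ B = X ∧ s(p, q) = s(a, b) := by
  induction h with
  | single x => exact Or.inl (HP.single x)
  | @cons X x w z hxw hx hp ih =>
    rcases ih with ih | ⟨A, B, p, q, h1, h2, h3, h4, h5⟩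
    · rcases hE _ _ hxw with e | e
      · exact Or.inl (HP.cons e hx ih)
      · exact Or.inr ⟨{x}, X, x, w, HP.single x, ih, by simpa using hx, by ext; simp, e⟩
    · rcases hE _ _ hxw with e | e
      · refine Or.inr ⟨insert x A, B, p, q, HP.cons e (fun c => hx ?_) h1, h2, ?_, ?_, h5⟩
        · rw [← h4]; exact Finset.mem_union_left _ c
        · rw [Finset.disjoint_insert_left]
          refine ⟨fun c => hx ?_, h3⟩
          rw [← h4]; exact Finset.mem_union_right _ c
        · rw [Finset.insert_union, h4]
      · exfalso
        have hp' : p ∈ X := by rw [← h4]; exact Finset.mem_union_left _ h1.right_mem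
        have hq' : q ∈ X := by rw [← h4]; exact Finset.mem_union_right _ h2.left_mem
        rw [← h5, Sym2.eq_iff] at e
        rcases e with ⟨rfl, -⟩ | ⟨rfl, -⟩
        · exact hx hp'
        · exact hx hq'

theorem HP.cross {F : SimpleGraph V} (S T : Finset V) {X : Finset V} {x y : V} (h : HP F X x y) :
    (∃ A B p q, HP F A x p ∧ HP F B q y ∧ Disjoint A B ∧ A ∪ B = X ∧ p ∈ T ∧ q ∈ S) ∨
      ((X ∩ S).erase x).card + ((X ∩ T).erase y).card + 1 ≤ X.card := by
  induction h with
  | single x =>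
    right
    have : ∀ S : Finset V, ({x} ∩ S).erase x = ∅ := by
      intro S; ext v; simp; tauto
    simp [this]
  | @cons X x w z hxw hx hp ih =>
    rcases ih with ⟨A, B, p, q, h1, h2, h3, h4, h5⟩ | ih
    · refine Or.inl ⟨insert x A, B, p, q, HP.cons hxw (fun c => hx ?_) h1, h2, ?_, ?_, h5⟩
      · rw [← h4]; exact Finset.mem_union_left _ c
      · rw [Finset.disjoint_insert_left]
        refine ⟨fun c => hx ?_, h3⟩
        rw [← h4]; exact Finset.mem_union_right _ c
      · rw [Finset.insert_union, h4]
    · by_cases hc : x ∈ T ∧ w ∈ S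
      · exact Or.inl ⟨{x}, X, x, w, HP.single x, hp, by simpa using hx, by ext; simp, hc⟩
      · right
        rw [Finset.card_insert_of_notMem hx]
        have e1 : ((insert x X ∩ S).erase x) = X ∩ S := by
          ext v
          simp only [Finset.mem_erase, Finset.mem_inter, Finset.mem_insert]
          constructor
          · rintro ⟨h1, h2 | h2, h3⟩
            · exact absurd h2 h1
            · exact ⟨h2, h3⟩
          · rintro ⟨h1, h2⟩
            exact ⟨fun e => hx (e ▸ h1), Or.inr h1, h2⟩
        rw [e1]
        by_cases hxT : x ∈ T
        · have hwS : w ∉ S := fun e => hc ⟨hxT, e⟩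
          have e2 : (X ∩ S).erase w = X ∩ S := Finset.erase_eq_of_notMem (by simp [hwS])
          have e3 : ((insert x X ∩ T).erase z) ⊆ insert x ((X ∩ T).erase z) := by
            intro v
            simp only [Finset.mem_erase, Finset.mem_inter, Finset.mem_insert]
            tauto
          have := (Finset.card_le_card e3).trans (Finset.card_insert_le _ _)
          rw [e2] at ih
          omega
        · have e3 : ((insert x X ∩ T).erase z) ⊆ ((X ∩ T).erase z) := by
            intro v
            simp only [Finset.mem_erase, Finset.mem_inter, Finset.mem_insert]
            rintro ⟨h1, rfl | h2, h3⟩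
            · exact absurd h3 hxT
            · exact ⟨h1, h2, h3⟩
          have := Finset.card_le_card e3
          have := Finset.pred_card_le_card_erase (s := X ∩ S) (a := w)
          omega

/-- the vertex sets of cycles (and edges) -/
def CycSet (F : SimpleGraph V) (X : Finset V) : Prop := ∃ x y, HP F X x y ∧ F.Adj y x

theorem bc_path [Fintype V] {E : SimpleGraph V} {X : Finset V} {a b : V} (h : HP E X a b)
    (S T : Finset V) (hS : ∀ v ∈ S, E.Adj a v) (hT : ∀ v ∈ T, E.Adj b v)
    (hc : Fintype.card V ≤ S.card + T.card) : ∃ X', CycSet E X' ∧ X.card ≤ X'.card := by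
  by_cases hw : ∃ w, w ∉ X ∧ w ∈ S ∧ w ∈ T
  · obtain ⟨w, h1, h2, h3⟩ := hw
    exact ⟨insert w X, ⟨w, b, HP.cons (hS _ h2).symm h1 h, hT _ h3⟩,
      Finset.card_le_card (Finset.subset_insert _ _)⟩
  · rcases h.cross S T with ⟨A, B, p, q, h1, h2, h3, h4, h5, h6⟩ | hcount
    · exact ⟨X, ⟨a, q, (h1.join h2.rev (hT _ h5).symm h3).congr_set h4, (hS _ h6).symm⟩, le_rfl⟩
    · exfalso
      have e1 : (X ∩ S).erase a = X ∩ S := Finset.erase_eq_of_notMem (by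
        rw [Finset.mem_inter]; rintro ⟨-, e⟩; exact (hS _ e).ne rfl)
      have e2 : (X ∩ T).erase b = X ∩ T := Finset.erase_eq_of_notMem (by
        rw [Finset.mem_inter]; rintro ⟨-, e⟩; exact (hT _ e).ne rfl)
      rw [e1, e2] at hcount
      have hd : Disjoint (S \ X) (T \ X) := by
        rw [Finset.disjoint_left]
        intro v h1 h2
        rw [Finset.mem_sdiff] at h1 h2
        exact hw ⟨v, h1.2, h1.1, h2.1⟩
      have hd2 : Disjoint (S \ X ∪ T \ X) X := by
        rw [Finset.disjoint_union_left]
        exact ⟨Finset.sdiff_disjoint, Finset.sdiff_disjoint⟩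
      have h7 := Finset.card_le_univ ((S \ X ∪ T \ X) ∪ X)
      rw [Finset.card_union_of_disjoint hd2, Finset.card_union_of_disjoint hd] at h7
      have h8 := Finset.card_sdiff_add_card_inter S X
      have h9 := Finset.card_sdiff_add_card_inter T X
      rw [Finset.inter_comm] at h8 h9
      omega

theorem bc_step [Fintype V] {E E1 : SimpleGraph V} {a b : V}
    (hE : ∀ x y, E.Adj x y → E1.Adj x y ∨ s(x, y) = s(a, b))
    (S T : Finset V) (hS : ∀ v ∈ S, E1.Adj a v) (hT : ∀ v ∈ T, E1.Adj b v)
    (hc : Fintype.card V ≤ S.card + T.card) {X : Finset V} (hX : CycSet E X) (h3 : 3 ≤ X.card) :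
    ∃ X', CycSet E1 X' ∧ X.card ≤ X'.card := by
  have fin : ∀ p q, HP E1 X p q → s(p, q) = s(a, b) → ∃ X', CycSet E1 X' ∧ X.card ≤ X'.card := by
    intro p q hp e
    rw [Sym2.eq_iff] at e
    rcases e with ⟨rfl, rfl⟩ | ⟨rfl, rfl⟩
    · exact bc_path hp S T hS hT hc
    · exact bc_path hp.rev S T hS hT hc
  obtain ⟨x, y, hp, hyx⟩ := hX
  rcases hp.split hE with h1 | ⟨A, B, p, q, hA, hB, hd, hU, e⟩
  · rcases hE _ _ hyx with e | e
    · exact ⟨X, ⟨x, y, h1, e⟩, le_rfl⟩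
    · exact fin y x h1.rev e
  · rcases hE _ _ hyx with e' | e'
    · refine fin q p ((hB.join hA e' hd.symm).congr_set ?_) ?_
      · rw [Finset.union_comm, hU]
      · rw [← e, Sym2.eq_swap]
    · exfalso
      rw [← e, Sym2.eq_iff] at e'
      rcases e' with ⟨h1, h2⟩ | ⟨h1, h2⟩
      · exact Finset.disjoint_left.1 hd hA.right_mem (h1 ▸ hB.right_mem)
      · have := hA.self h2
        have h4 := hB.self h1.symm
        subst this h4
        have := Finset.card_union_le {x} {q}
        rw [hU] at this
        simp at this
        omega

theorem bc [Fintype V] {G : SimpleGraph V} [DecidableRel G.Adj] {F : SimpleGraph V}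
    (hF : ∀ x y, F.Adj x y → G.Adj x y ∨
      (Fintype.card V ≤ 2 * G.degree x ∧ Fintype.card V ≤ 2 * G.degree y)) :
    ∀ E : SimpleGraph V, G ≤ E → E ≤ F → ∀ X, CycSet E X → 3 ≤ X.card →
      ∃ X', CycSet G X' ∧ X.card ≤ X'.card := by
  intro E
  induction E using WellFoundedLT.induction with
  | ind E ih =>
    intro hGE hEF X hX h3
    by_cases hEG : E ≤ G
    · obtain ⟨x, y, h1, h2⟩ := hX
      exact ⟨X, ⟨x, y, h1.mono hEG, hEG h2⟩, le_rfl⟩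
    · rw [SimpleGraph.le_iff_adj] at hEG
      push Not at hEG
      obtain ⟨a, b, hab, hnab⟩ := hEG
      have hdel : ∀ x y, (E.deleteEdges {s(a,b)}).Adj x y ↔ E.Adj x y ∧ s(x,y) ≠ s(a,b) := by
        intro x y
        rw [SimpleGraph.deleteEdges_adj, Set.mem_singleton_iff]
      have hG1 : G ≤ E.deleteEdges {s(a,b)} := by
        intro x y hxy
        rw [hdel]
        refine ⟨hGE hxy, fun e => hnab ?_⟩
        rw [Sym2.eq_iff] at e
        rcases e with ⟨rfl, rfl⟩ | ⟨rfl, rfl⟩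
        · exact hxy
        · exact hxy.symm
      have hE1 : E.deleteEdges {s(a,b)} ≤ E := SimpleGraph.deleteEdges_le _
      have hlt : E.deleteEdges {s(a,b)} < E := by
        refine lt_of_le_of_ne hE1 (fun e => ?_)
        have := hab
        rw [← e, hdel] at this
        exact this.2 rfl
      rcases hF a b (hEF hab) with e | ⟨ha, hb⟩
      · exact absurd e hnab
      obtain ⟨X1, c1, c2⟩ := bc_step (E := E) (E1 := E.deleteEdges {s(a,b)}) (a := a) (b := b) (by
        intro x y hxy
        rw [hdel]
        tauto) (G.neighborFinset a) (G.neighborFinset b)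
        (fun v hv => hG1 ((G.mem_neighborFinset _ _).1 hv))
        (fun v hv => hG1 ((G.mem_neighborFinset _ _).1 hv)) (by
          rw [SimpleGraph.card_neighborFinset_eq_degree, SimpleGraph.card_neighborFinset_eq_degree]
          omega) hX h3
      obtain ⟨X2, c3, c4⟩ := ih _ hlt hG1 (hE1.trans hEF) X1 c1 (by omega)
      exact ⟨X2, c3, by omega⟩

end ClosureSection


section FinalSection

variable {V : Type} [DecidableEq V]

theorem boundary [Fintype V] {G : SimpleGraph V} (h2 : TwoConnected G) (v : V) (D : Set V) {x y : V}
    (hx : x ∈ D) (hxv : x ≠ v) (hy : y ∉ D) (hyv : y ≠ v) :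
    ∃ a b, a ∈ D ∧ b ∉ D ∧ a ≠ v ∧ b ≠ v ∧ G.Adj a b := by
  obtain ⟨p⟩ := (h2.2 v).preconnected ⟨x, hxv⟩ ⟨y, hyv⟩
  obtain ⟨d, -, h3, h4⟩ := p.exists_boundary_dart {w | w.1 ∈ D} hx hy
  exact ⟨d.fst.1, d.snd.1, h3, h4, d.fst.2, d.snd.2, d.adj⟩

theorem exists_ne_ne [Fintype V] (h : 3 ≤ Fintype.card V) (x y : V) : ∃ z, z ≠ x ∧ z ≠ y := by
  have : ({x, y} : Finset V).card < Fintype.card V := by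
    have := Finset.card_le_two (a := x) (b := y)
    omega
  obtain ⟨z, hz⟩ := Finset.exists_mem_notMem_of_card_lt_card (s := {x, y}) (t := Finset.univ) (by
    simpa using this)
  simp at hz
  exact ⟨z, hz⟩

theorem two_nbrs [Fintype V] {G : SimpleGraph V} (h2 : TwoConnected G) (x v : V) (hv : v ≠ x) :
    ∃ w, w ≠ v ∧ G.Adj x w := by
  obtain ⟨z, hz1, hz2⟩ := exists_ne_ne h2.1 x v
  obtain ⟨a, b, h3, h4, h5, h6, h7⟩ := boundary h2 v {x} rfl hv.symm (y := z) hz1 hz2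
  rw [Set.mem_singleton_iff] at h3
  subst h3
  exact ⟨b, h6, h7⟩

theorem exists_cyc [Fintype V] {G : SimpleGraph V} (h2 : TwoConnected G) :
    ∃ X, CycSet G X ∧ 3 ≤ X.card := by
  classical
  have hne : (Finset.univ.filter (fun X : Finset V => ∃ x y, HP G X x y)).Nonempty := by
    have : 0 < Fintype.card V := by have := h2.1; omega
    obtain ⟨x⟩ := Fintype.card_pos_iff.1 this
    exact ⟨{x}, by simp; exact ⟨x, x, HP.single x⟩⟩
  obtain ⟨X, hX, hmax⟩ := Finset.exists_max_image _ Finset.card hne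
  simp only [Finset.mem_filter, Finset.mem_univ, true_and] at hX hmax
  obtain ⟨x, y, hp⟩ := hX
  have hin : ∀ w, G.Adj x w → w ∈ X := by
    intro w hw
    by_contra hc
    have := hmax (insert w X) ⟨w, y, HP.cons hw.symm hc hp⟩
    rw [Finset.card_insert_of_notMem hc] at this
    omega
  cases hp with
  | single =>
    obtain ⟨z, hz, -⟩ := exists_ne_ne h2.1 x x
    obtain ⟨w, -, hw⟩ := two_nbrs h2 x z hz
    have := hin w hw
    simp at this
    exact absurd this.symm hw.ne
  | @cons X x w z hxw hx hp =>
    obtain ⟨v, hvw, hxv⟩ := two_nbrs h2 x w hxw.ne'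
    have hvX : v ∈ X := by
      have := hin v hxv
      rw [Finset.mem_insert] at this
      rcases this with e | e
      · exact absurd e.symm hxv.ne
      · exact e
    obtain ⟨A, hA, hpA⟩ := hp.initial_mem hvX
    have hxA : x ∉ A := fun e => hx (hA e)
    refine ⟨insert x A, ⟨x, v, HP.cons hxw hxA hpA, hxv.symm⟩, ?_⟩
    rw [Finset.card_insert_of_notMem hxA]
    have := hpA.card_two hvw.symm
    omega

theorem ham_of [Fintype V] {G : SimpleGraph V} {X : Finset V} (hX : CycSet G X) (h3 : 3 ≤ X.card)
    (hall : ∀ v, v ∈ X) : IsHamiltonianGraph G := by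
  obtain ⟨x, y, hp, hyx⟩ := hX
  obtain ⟨p, h1, h2⟩ := hp.exists_walk
  refine ⟨y, SimpleGraph.Walk.cons hyx p, ?_, ?_⟩
  · rw [SimpleGraph.Walk.cons_isCycle_iff]
    refine ⟨h1, ?_⟩
    cases p with
    | nil => simp
    | @cons _ w _ hxw q =>
      rw [SimpleGraph.Walk.cons_isPath_iff] at h1
      rw [SimpleGraph.Walk.edges_cons, List.mem_cons]
      rintro (e | e)
      · rw [Sym2.eq_iff] at e
        rcases e with ⟨e, -⟩ | ⟨e, -⟩
        · exact hyx.ne e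
        · subst e
          have hq := SimpleGraph.Walk.isPath_iff_eq_nil.1 h1.1
          subst hq
          have : X ⊆ {x, y} := by
            intro v hv
            have := (h2 v).2 hv
            simpa using this
          have := (Finset.card_le_card this).trans Finset.card_le_two
          omega
      · exact h1.2 (SimpleGraph.Walk.snd_mem_support_of_mem_edges _ e)
  · intro v
    rw [SimpleGraph.Walk.support_cons]
    exact List.mem_cons_of_mem _ ((h2 v).2 (hall v))

theorem exists_param {G : SimpleGraph V} {X : Finset V} (hX : CycSet G X) (h3 : 3 ≤ X.card) :
    ∃ u : ℤ → V, (∀ t, u (t + X.card) = u t) ∧ (∀ s t : ℤ, s < t → t < s + (X.card : ℤ) → u s ≠ u t) ∧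
      (∀ t, G.Adj (u t) (u (t+1))) ∧ (∀ v, v ∈ X ↔ ∃ t, u t = v) := by
  obtain ⟨x, y, hp, hyx⟩ := hX
  obtain ⟨f, f0, fl, fa, fm, fi⟩ := hp.exists_fun
  set N : ℤ := (X.card : ℤ) with hN
  have hNp : 0 < N := by omega
  have hlt : ∀ t : ℤ, (t % N).toNat < X.card := by
    intro t
    have := Int.emod_lt_of_pos t hNp
    omega
  have hnn : ∀ t : ℤ, 0 ≤ t % N := fun t => Int.emod_nonneg t (by omega)
  have hinj : ∀ s t, s < t → t < s + N → f (s % N).toNat ≠ f (t % N).toNat := by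
    intro s t h1 h2 e
    have := fi _ _ (hlt s) (hlt t) e
    have h4 : s % N = t % N := by
      have := hnn s
      have := hnn t
      omega
    have h5 : (t - s) % N = 0 := Int.emod_eq_emod_iff_emod_sub_eq_zero.1 h4.symm
    rw [Int.emod_eq_of_lt (by omega) (by omega)] at h5
    omega
  refine ⟨fun t => f (t % N).toNat, ?_, hinj, ?_, ?_⟩
  · intro t
    simp
  · intro t
    show G.Adj (f (t % N).toNat) (f ((t+1) % N).toNat)
    have h5 := Int.emod_lt_of_pos t hNp
    have h6 := hnn t
    have h7 : (t + 1) % N = (t % N + 1) % N := by simp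
    by_cases c : t % N + 1 = N
    · rw [h7, c, Int.emod_self]
      have : (t % N).toNat = X.card - 1 := by omega
      rw [this, fl]
      simpa [f0] using hyx
    · rw [h7, Int.emod_eq_of_lt (a := t % N + 1) (b := N) (by omega) (by omega)]
      have := fa (t % N).toNat (by omega)
      rwa [show (t % N).toNat + 1 = (t % N + 1).toNat by omega] at this
  · intro v
    constructor
    · have hsub : (Finset.range X.card).image f ⊆ X := by
        intro v hv
        rw [Finset.mem_image] at hv
        obtain ⟨k, hk, rfl⟩ := hv
        exact fm k (by simpa using hk)
      have := Finset.eq_of_subset_of_card_le hsub (by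
        rw [Finset.card_image_of_injOn, Finset.card_range]
        intro k hk l hl e
        exact fi k l (by simpa using hk) (by simpa using hl) e)
      intro hv
      rw [← this, Finset.mem_image] at hv
      obtain ⟨k, hk, rfl⟩ := hv
      refine ⟨k, ?_⟩
      rw [Finset.mem_range] at hk
      show f ((k:ℤ) % N).toNat = f k
      rw [Int.emod_eq_of_lt (by omega) (by omega)]
      simp
    · rintro ⟨t, rfl⟩
      exact fm _ (hlt t)

/-- The closure used in the proof: all edges between heavy vertices are added. -/
def heavyClosure [Fintype V] (G : SimpleGraph V) [DecidableRel G.Adj] : SimpleGraph V where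
  Adj x y := G.Adj x y ∨ (x ≠ y ∧ ¬ ¬ Fintype.card V ≤ 2 * G.degree x ∧
    ¬ ¬ Fintype.card V ≤ 2 * G.degree y)
  symm := ⟨fun x y h => by
    rcases h with h | ⟨h1, h2, h3⟩
    · exact Or.inl h.symm
    · exact Or.inr ⟨h1.symm, h3, h2⟩⟩
  loopless := ⟨fun x h => by
    rcases h with h | ⟨h1, -⟩
    · exact h.ne rfl
    · exact h1 rfl⟩

theorem main_aux [Fintype V] (G : SimpleGraph V) [DecidableRel G.Adj]
    (h2 : TwoConnected G) (hclaw : FHeavy G claw) (hW : FHeavy G woundedGraph) :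
    IsHamiltonianGraph G := by
  classical
  obtain ⟨X0, hX0, hX03⟩ := exists_cyc h2
  obtain ⟨X, hX, hmax⟩ := Finset.exists_max_image
    (Finset.univ.filter (fun X : Finset V => CycSet G X)) Finset.card ⟨X0, by simpa using hX0⟩
  simp only [Finset.mem_filter, Finset.mem_univ, true_and] at hX hmax
  have h3 : 3 ≤ X.card := hX03.trans (hmax _ hX0)
  by_cases hall : ∀ v, v ∈ X
  · exact ham_of hX h3 hall
  exfalso
  push Not at hall
  obtain ⟨v0, hv0⟩ := hall
  obtain ⟨u, uper, uinj, uadj, uX⟩ := exists_param hX h3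
  have hcy : Cy (heavyClosure G) u X.card := by
    refine ⟨by exact_mod_cast h3, uper, uinj, fun t => Or.inl (uadj t), ?_⟩
    intro Y x y hp hyx
    by_cases hY : 3 ≤ Y.card
    · obtain ⟨X', h4, h5⟩ := bc (G := G) (F := heavyClosure G) (fun x y e => by
        rcases e with e | ⟨-, e1, e2⟩
        · exact Or.inl e
        · exact Or.inr ⟨not_not.1 e1, not_not.1 e2⟩) (heavyClosure G) (fun x y e => Or.inl e) le_rfl Y
        ⟨x, y, hp, hyx⟩ hY
      have := hmax X' h4
      omega
    · omega
  -- an ear exists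
  have hear : ∃ k : ℕ, ∃ Z' a b s t, HP G Z' a b ∧ (∀ t, u t ∉ Z') ∧ G.Adj (u s) a ∧
      G.Adj b (u t) ∧ u s ≠ u t ∧ Z'.card = k := by
    obtain ⟨a, z0, ha, hz0, -, -, haz⟩ := boundary h2 (u 0) (X : Set V) (x := u 1) (y := v0)
      ((uX _).2 ⟨1, rfl⟩) (fun e => uinj 0 1 (by omega) (by omega) e.symm) hv0
      (fun e => hv0 ((uX _).2 ⟨0, e.symm⟩))
    obtain ⟨s, hs⟩ := (uX a).1 ha
    have hz0' : ∀ t, u t ≠ z0 := fun t e => hz0 ((uX _).2 ⟨t, e⟩)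
    obtain ⟨p, q, ⟨Z', hp, hoff⟩, hq, -, hqa, hpq⟩ := boundary h2 a
      {w | ∃ Z', HP G Z' z0 w ∧ ∀ t, u t ∉ Z'} (x := z0) (y := u (s+1))
      ⟨{z0}, HP.single z0, fun t => by simpa using hz0' t⟩ haz.ne'
      (fun ⟨Z', h4, h5⟩ => h5 _ h4.right_mem)
      (fun e => uinj s (s+1) (by omega) (by omega) (hs.trans e.symm))
    have hqC : ∃ t, u t = q := by
      by_contra hc
      push Not at hc
      apply hq
      by_cases hqZ : q ∈ Z'
      · obtain ⟨A, hA, hpA⟩ := hp.initial_mem hqZ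
        exact ⟨A, hpA, fun t e => hoff t (hA e)⟩
      · refine ⟨_, hp.snoc hpq hqZ, fun t e => ?_⟩
        rw [Finset.mem_insert] at e
        rcases e with e | e
        · exact hc t e
        · exact hoff t e
    obtain ⟨t, ht⟩ := hqC
    exact ⟨_, Z', z0, p, s, t, hp, hoff, by rw [hs]; exact haz, by rw [ht]; exact hpq,
      by rw [hs, ht]; exact hqa.symm, rfl⟩
  obtain ⟨Z, z1, zr, s, t, hZ, hoff, a1, a2, hne, hcard⟩ := Nat.find_spec hear
  have hmin : ∀ Z' a b s t, HP G Z' a b → (∀ t, u t ∉ Z') → G.Adj (u s) a → G.Adj b (u t) →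
      u s ≠ u t → Z.card ≤ Z'.card := by
    intro Z' a b s t h4 h5 h6 h7 h8
    rw [hcard]
    exact Nat.find_min' hear ⟨Z', a, b, s, t, h4, h5, h6, h7, h8, rfl⟩
  obtain ⟨r, r1, r2, r3⟩ := hcy.window t s
  have hrs : r ≠ s := by rintro rfl; exact hne r3
  have hctx : Ctx G (heavyClosure G) (fun v => ¬ Fintype.card V ≤ 2 * G.degree v)
      (fun k => u (k + s)) X.card (r - s) Z z1 zr := by
    have e0 : u (0 + s) = u s := by rw [zero_add]
    have e1 : u (r - s + s) = u t := by rw [sub_add_cancel, r3]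
    refine ⟨⟨hcy.shift s, by omega, by omega, hZ.mono (fun x y e => Or.inl e), fun t => hoff _, ?_, ?_⟩,
      fun x y => Iff.rfl, clawLt_of G hclaw, wLt_of G hW, ?_, ?_, ?_, hZ, ?_⟩
    · refine Or.inl ?_
      rw [e0]; exact a1
    · refine Or.inl ?_
      rw [e1]; exact a2
    · intro k
      have := uadj (k + s)
      rwa [show k + s + 1 = k + 1 + s by ring] at this
    · show G.Adj (u (0 + s)) z1
      rw [e0]; exact a1
    · show G.Adj zr (u (r - s + s))
      rw [e1]; exact a2
    · intro Z' a b s' t' h4 h5 h6 h7 h8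
      exact hmin Z' a b _ _ h4 (fun k => by simpa using h5 (k - s)) h6 h7 h8
  exact hctx.final

end FinalSection

theorem hamiltonian_of_claw_wounded_f_heavy {V : Type} [Fintype V]
    (G : SimpleGraph V) [DecidableRel G.Adj]
    (h2 : TwoConnected G) (hclaw : FHeavy G claw) (hW : FHeavy G woundedGraph) :
    IsHamiltonianGraph G := by
  classical
  exact main_aux G h2 hclaw hW
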